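/- arXiv:1306.3638 — 2 statements merged into one kernel-verified Lean document; each statement's English description precedes it below -/
import Mathlib

section
/- Let θ ∈ ℝⁿ with |θ| = 1, let x ∈ ℝⁿ with θ·x = 0, let r ∈ (0,1), and let s ≥ μ satisfy s > 2^{3/2} r and 4βn(|x|+1)(1 + 1/(2^{−3/2}s − r))² ≤ α r (2^{−3/2}s − r)(1−r)^{α+2}. Then the map A (with v_− = sθ, x_− = x) has a unique fixed point y_− in M_r, and, setting a_sc(sθ,x) := ∫_{−∞}^∞ F(z_−(sθ,τ) + x + y_−(τ)) dτ, one has |a_sc(sθ,x) − ∫_{−∞}^∞ F(τ sθ + x) dτ| ≤ 4n²(3|x|+5)β²(1 + 1/(2^{−3/2}s − r))² / (α²(1−r)^{2α+3}(2^{−3/2}s − r)²). -/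
open MeasureTheory Real Filter Set Topology RealInnerProductSpace

noncomputable section

namespace Paper

/-- ℝⁿ -/
abbrev Euc (n : ℕ) : Type := EuclideanSpace ℝ (Fin n)

variable {n : ℕ}

/-- the norm `sup_{t ≤ 0} ‖f t‖ + sup_{t ≥ 0} ‖f t‖/(1+t)` on the space `M_r`. -/
def Mnorm (f : ℝ → Euc n) : ℝ :=
  sSup ((fun t => ‖f t‖) '' Iic 0) + sSup ((fun t => ‖f t‖ / (1 + t)) '' Ici 0)

/-- membership in the complete metric space `M_r`. -/
def MemM (r : ℝ) (f : ℝ → Euc n) : Prop :=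
  Continuous f ∧ BddAbove ((fun t => ‖f t‖) '' Iic 0) ∧
    BddAbove ((fun t => ‖f t‖ / (1 + t)) '' Ici 0) ∧ Mnorm f ≤ r

/-- the long range decay conditions on `V^l`. -/
def LongRange (α βl0 βl1 βl2 : ℝ) (Vl : Euc n → ℝ) : Prop :=
  ContDiff ℝ 2 Vl ∧
    (∀ x, |Vl x| ≤ βl0 * (1 + ‖x‖) ^ (-α)) ∧
    (∀ x, ‖gradient Vl x‖ ≤ βl1 * (1 + ‖x‖) ^ (-(α + 1))) ∧
    (∀ x, ‖iteratedFDeriv ℝ 2 Vl x‖ ≤ βl2 * (1 + ‖x‖) ^ (-(α + 2)))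

/-- the short range decay conditions on `V^s`. -/
def ShortRange (α βs1 βs2 βs3 : ℝ) (Vs : Euc n → ℝ) : Prop :=
  ContDiff ℝ 2 Vs ∧
    (∀ x, |Vs x| ≤ βs1 * (1 + ‖x‖) ^ (-(α + 1))) ∧
    (∀ x, ‖gradient Vs x‖ ≤ βs2 * (1 + ‖x‖) ^ (-(α + 2))) ∧
    (∀ x, ‖iteratedFDeriv ℝ 2 Vs x‖ ≤ βs3 * (1 + ‖x‖) ^ (-(α + 3)))

/-- `z` is a C² solution of `z'' = Fl ∘ z` with `z 0 = x0`, `z' → w` along the filter `l`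
(`atBot` for `z_-`, `atTop` for `z_+`), satisfying the growth bound `‖z t - x0 - t w‖ ≤ C |t|`. -/
def IsFreeSol (Fl : Euc n → Euc n) (x0 w : Euc n) (l : Filter ℝ) (C : ℝ)
    (z : ℝ → Euc n) : Prop :=
  ContDiff ℝ 2 z ∧ (∀ t, deriv (deriv z) t = Fl (z t)) ∧ z 0 = x0 ∧
    Tendsto (fun t => deriv z t) l (𝓝 w) ∧ ∀ t, ‖z t - x0 - t • w‖ ≤ C * |t|

/-- the map `A` (or `𝒜` when `xm = 0` and `zm` already contains the base point). -/
def Aop (Fl F : Euc n → Euc n) (zm : ℝ → Euc n) (xm : Euc n)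
    (f : ℝ → Euc n) (t : ℝ) : Euc n :=
  ∫ σ in Iic t, ∫ τ in Iic σ, (F (zm τ + xm + f τ) - Fl (zm τ))

/-- the vector `l(v_-,x_-,y_-)`. -/
def lInt (Fl Fs F : Euc n → Euc n) (zm : ℝ → Euc n) (xm : Euc n) (ym : ℝ → Euc n) : Euc n :=
  (∫ σ in Iic (0:ℝ), ∫ τ in Iic σ, (F (zm τ + xm + ym τ) - Fl (zm τ))) -
    ∫ σ in Ici (0:ℝ), ∫ τ in Ici σ, Fs (zm τ + xm + ym τ)

/-- the vector `l₁(v_-,x_-)`. -/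
def l1Int (Fl : Euc n → Euc n) (zp : ℝ → Euc n) (xm : Euc n) : Euc n :=
  -∫ σ in Ici (0:ℝ), ∫ τ in Ici σ, (Fl (zp τ + xm) - Fl (zp τ))

/-- the vector `l₂(v_-,x_-,y_-)`. -/
def l2Int (Fl : Euc n → Euc n) (zm zp : ℝ → Euc n) (xm : Euc n) (ym : ℝ → Euc n) : Euc n :=
  -∫ σ in Ici (0:ℝ), ∫ τ in Ici σ, (Fl (zm τ + xm + ym τ) - Fl (zp τ + xm))

/-- the function `y_+`. -/
def yplusInt (Fl F : Euc n → Euc n) (zm zp : ℝ → Euc n) (xm : Euc n) (ym : ℝ → Euc n)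
    (t : ℝ) : Euc n :=
  ∫ σ in Ici t, ∫ τ in Ici σ, (F (zm τ + xm + ym τ) - Fl (zp τ))

/-- the vector `W(v_-,x_-)`. -/
def Wvec (Fl : Euc n → Euc n) (zm zp : ℝ → Euc n) (xm : Euc n) : Euc n :=
  (∫ σ in Iic (0:ℝ), ∫ τ in Iic σ, (Fl (zm τ + xm) - Fl (zm τ))) -
    ∫ σ in Ici (0:ℝ), ∫ τ in Ici σ, (Fl (zp τ + xm) - Fl (zp τ))

/-- the map `𝒢_{v_-,x_-}`; here `zm = z_-(v_-,x_-,·)` contains the base point `x_-`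
and `zp h = z_+(ã, x_- + h, ·)`. -/
def Gmap (Fl Fs F : Euc n → Euc n) (zm : ℝ → Euc n) (zp : Euc n → ℝ → Euc n)
    (ym : ℝ → Euc n) (h : Euc n) : Euc n :=
  lInt Fl Fs F zm 0 ym -
    ∫ σ in Ici (0:ℝ), ∫ τ in Ici σ, (Fl (zm τ + ym τ) - Fl (zp h τ))

/-- the vector `W̃(v_-,x_-)`; here `zp0 = z_+(ã, x_-, ·)`. -/
def Wtilde (Fl : Euc n → Euc n) (zm zp0 : ℝ → Euc n) : Euc n :=
  (∫ τ in Iic (0:ℝ), Fl (zm τ)) + ∫ τ in Ici (0:ℝ), Fl (zp0 τ)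

/-- the decay kernel `(u + ρ |τ|) ^ (-a)`. -/
def decay (u ρ a τ : ℝ) : ℝ := (u + ρ * |τ|) ^ (-a)

/-- the growth weight, equal to `1` on the negative axis and to `1 + t` on the positive axis. -/
def growth (t : ℝ) : ℝ := 1 + max t 0

lemma growth_pos (t : ℝ) : 0 < growth t := by
  have := le_max_right t 0
  unfold growth
  linarith

lemma one_le_growth (t : ℝ) : 1 ≤ growth t := by
  have := le_max_right t 0
  unfold growth
  linarith

lemma growth_le (t : ℝ) : growth t ≤ 1 + |t| := by
  have : max t 0 ≤ |t| := max_le (le_abs_self t) (abs_nonneg t)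
  unfold growth
  linarith

lemma continuous_growth : Continuous growth := by
  unfold growth
  fun_prop

section Decay

variable {u ρ a : ℝ}

lemma decay_base_pos (hu : 0 < u) (hρ : 0 < ρ) (τ : ℝ) : 0 < u + ρ * |τ| := by
  positivity

lemma decay_pos (hu : 0 < u) (hρ : 0 < ρ) (τ : ℝ) : 0 < decay u ρ a τ :=
  Real.rpow_pos_of_pos (decay_base_pos hu hρ τ) _

lemma continuous_decay (hu : 0 < u) (hρ : 0 < ρ) : Continuous (decay u ρ a) := by
  unfold decay
  exact Continuous.rpow_const (by fun_prop) fun τ => Or.inl (decay_base_pos hu hρ τ).ne'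

lemma abs_mul_decay_le (hu : 0 < u) (hρ : 0 < ρ) (τ : ℝ) :
    |τ| * decay u ρ (a + 1) τ ≤ decay u ρ a τ / ρ := by
  have h := decay_base_pos hu hρ τ
  have h1 : decay u ρ a τ = (u + ρ * |τ|) * decay u ρ (a + 1) τ := by
    unfold decay
    rw [show -a = 1 + -(a + 1) by ring, Real.rpow_add h, Real.rpow_one]
  rw [h1, le_div_iff₀ hρ]
  nlinarith [mul_pos hu (decay_pos (a := a + 1) hu hρ τ)]

lemma hasDerivAt_decay_primitive (ha : 1 < a) (hρ : 0 < ρ) {x : ℝ} (h : 0 < u + ρ * x) :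
    HasDerivAt (fun x : ℝ => -(u + ρ * x) ^ (-(a - 1)) / ((a - 1) * ρ))
      ((u + ρ * x) ^ (-a)) x := by
  have h1 : HasDerivAt (fun x : ℝ => u + ρ * x) ρ x := by
    simpa using ((hasDerivAt_id x).const_mul ρ).const_add u
  have h2 := ((h1.rpow_const (p := -(a - 1)) (Or.inl h.ne')).neg).div_const ((a - 1) * ρ)
  have ha' : a - 1 ≠ 0 := by linarith
  have h3 : -(ρ * -(a - 1) * (u + ρ * x) ^ (-(a - 1) - 1)) / ((a - 1) * ρ) =
      (u + ρ * x) ^ (-a) := by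
    rw [show -(a - 1) - 1 = -a by ring]
    field_simp
  rw [← h3]
  exact h2

lemma tendsto_decay_primitive (ha : 1 < a) (hρ : 0 < ρ) :
    Tendsto (fun x : ℝ => -(u + ρ * x) ^ (-(a - 1)) / ((a - 1) * ρ)) atTop (𝓝 0) := by
  have h1 : Tendsto (fun x : ℝ => u + ρ * x) atTop atTop :=
    tendsto_atTop_add_const_left _ _ (tendsto_id.const_mul_atTop hρ)
  have h2 := (tendsto_rpow_neg_atTop (y := a - 1) (by linarith)).comp h1
  simpa using h2.neg.div_const ((a - 1) * ρ)

lemma integral_Ioi_decay (ha : 1 < a) (hu : 0 < u) (hρ : 0 < ρ) {c : ℝ} (hc : 0 ≤ c) :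
    IntegrableOn (decay u ρ a) (Ioi c) ∧
      ∫ τ in Ioi c, decay u ρ a τ = decay u ρ (a - 1) c / ((a - 1) * ρ) := by
  have hpos : ∀ x ∈ Ici c, 0 < u + ρ * x := fun x hx => by
    have := mul_nonneg hρ.le (hc.trans hx)
    linarith
  have hd : ∀ x ∈ Ici c, HasDerivAt _ _ x := fun x hx =>
    hasDerivAt_decay_primitive ha hρ (hpos x hx)
  have hn : ∀ x ∈ Ioi c, 0 ≤ (u + ρ * x) ^ (-a) := fun x hx =>
    (Real.rpow_pos_of_pos (hpos x (mem_Ici_of_Ioi hx)) _).le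
  have heq : EqOn (fun x : ℝ => (u + ρ * x) ^ (-a)) (decay u ρ a) (Ioi c) := fun x hx => by
    simp only [decay, abs_of_nonneg (hc.trans (le_of_lt hx))]
  constructor
  · exact (integrableOn_Ioi_deriv_of_nonneg' hd hn (tendsto_decay_primitive ha hρ)).congr_fun heq
      measurableSet_Ioi
  · rw [← setIntegral_congr_fun measurableSet_Ioi heq,
      integral_Ioi_of_hasDerivAt_of_nonneg' hd hn (tendsto_decay_primitive ha hρ)]
    simp only [decay, abs_of_nonneg hc]
    ring

lemma decay_neg (τ : ℝ) : decay u ρ a (-τ) = decay u ρ a τ := by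
  simp [decay]

lemma integral_Iic_decay (ha : 1 < a) (hu : 0 < u) (hρ : 0 < ρ) {c : ℝ} (hc : c ≤ 0) :
    IntegrableOn (decay u ρ a) (Iic c) ∧
      ∫ τ in Iic c, decay u ρ a τ = decay u ρ (a - 1) c / ((a - 1) * ρ) := by
  obtain ⟨h1, h2⟩ := integral_Ioi_decay ha hu hρ (c := -c) (by linarith)
  constructor
  · rw [integrableOn_Iic_iff_integrableOn_Iio]
    simpa [decay_neg] using h1.comp_neg
  · have := integral_comp_neg_Iic c (decay u ρ a)
    simp only [decay_neg] at this
    rw [this, h2, decay_neg]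

lemma integrable_decay (ha : 1 < a) (hu : 0 < u) (hρ : 0 < ρ) :
    Integrable (decay u ρ a) := by
  rw [← integrableOn_univ, ← Iic_union_Ioi (a := (0 : ℝ))]
  exact (integral_Iic_decay ha hu hρ le_rfl).1.union (integral_Ioi_decay ha hu hρ le_rfl).1

lemma integral_decay (ha : 1 < a) (hu : 0 < u) (hρ : 0 < ρ) :
    ∫ τ, decay u ρ a τ = 2 * (u ^ (-(a - 1)) / ((a - 1) * ρ)) := by
  rw [← intervalIntegral.integral_Iic_add_Ioi (integral_Iic_decay ha hu hρ le_rfl).1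
    (integral_Ioi_decay ha hu hρ le_rfl).1, (integral_Iic_decay ha hu hρ le_rfl).2,
    (integral_Ioi_decay ha hu hρ le_rfl).2]
  simp only [decay, abs_zero, mul_zero, add_zero]
  ring

lemma growth_mul_decay_le (hu : 0 < u) (hρ : 0 < ρ) (τ : ℝ) :
    growth τ * decay u ρ (a + 1) τ ≤
      decay u ρ (a + 1) τ + (Ioi (0 : ℝ)).indicator (fun τ => decay u ρ a τ / ρ) τ := by
  by_cases h : τ ∈ Ioi (0 : ℝ)
  · rw [indicator_of_mem h]
    have h2 := abs_mul_decay_le (a := a) hu hρ τ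
    have h3 := mul_le_mul_of_nonneg_right (growth_le τ) (decay_pos (a := a + 1) hu hρ τ).le
    linarith
  · rw [indicator_of_notMem h]
    have : max τ 0 = 0 := max_eq_right (by simpa using h)
    simp [growth, this]

lemma integrable_growth_mul_decay (ha : 1 < a) (hu : 0 < u) (hρ : 0 < ρ) :
    Integrable fun τ => growth τ * decay u ρ (a + 1) τ := by
  refine Integrable.mono'
    ((integrable_decay (a := a + 1) (by linarith) hu hρ).add
      (((integrable_decay ha hu hρ).div_const ρ).indicator (measurableSet_Ioi (a := (0 : ℝ)))))
    (continuous_growth.mul (continuous_decay hu hρ)).aestronglyMeasurable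
    (Eventually.of_forall fun τ => ?_)
  rw [Real.norm_of_nonneg (mul_pos (growth_pos τ) (decay_pos hu hρ τ)).le]
  exact growth_mul_decay_le hu hρ τ

lemma integrable_abs_mul_decay (ha : 1 < a) (hu : 0 < u) (hρ : 0 < ρ) :
    Integrable fun τ => |τ| * decay u ρ (a + 1) τ := by
  refine Integrable.mono' ((integrable_decay ha hu hρ).div_const ρ)
    (continuous_abs.mul (continuous_decay hu hρ)).aestronglyMeasurable
    (Eventually.of_forall fun τ => ?_)
  rw [Real.norm_of_nonneg (mul_nonneg (abs_nonneg τ) (decay_pos hu hρ τ).le)]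
  exact abs_mul_decay_le hu hρ τ

lemma integral_abs_mul_decay_le (ha : 1 < a) (hu : 0 < u) (hρ : 0 < ρ) :
    ∫ τ, |τ| * decay u ρ (a + 1) τ ≤ 2 * (u ^ (-(a - 1)) / ((a - 1) * ρ)) / ρ := by
  calc ∫ τ, |τ| * decay u ρ (a + 1) τ ≤ ∫ τ, decay u ρ a τ / ρ :=
        integral_mono (integrable_abs_mul_decay ha hu hρ)
          ((integrable_decay ha hu hρ).div_const ρ) fun τ => abs_mul_decay_le hu hρ τ
    _ = _ := by rw [integral_div, integral_decay ha hu hρ]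

/-- the common bound for the weighted integrals of the decay kernel of order `α + 2`. -/
def decayConst (u ρ α : ℝ) : ℝ := (1 + 1 / ρ) / (α * ρ) * u ^ (-(α + 1))

variable {α : ℝ}

lemma decayConst_pos (hα0 : 0 < α) (hu : 0 < u) (hρ : 0 < ρ) : 0 < decayConst u ρ α := by
  unfold decayConst
  positivity

lemma integral_growth_mul_decay_le (hα0 : 0 < α) (hα1 : α ≤ 1) (hu : 0 < u) (hu1 : u ≤ 1)
    (hρ : 0 < ρ) : ∫ τ, growth τ * decay u ρ (α + 2) τ ≤ decayConst u ρ α := by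
  have e : α + 2 = (α + 1) + 1 := by ring
  have h1 : 1 < α + 1 := by linarith
  have h2 : 1 < (α + 1) + 1 := by linarith
  rw [e]
  calc ∫ τ, growth τ * decay u ρ (α + 1 + 1) τ
      ≤ ∫ τ, (decay u ρ (α + 1 + 1) τ +
          (Ioi (0 : ℝ)).indicator (fun τ => decay u ρ (α + 1) τ / ρ) τ) :=
        integral_mono (integrable_growth_mul_decay h1 hu hρ)
          ((integrable_decay h2 hu hρ).add
            (((integrable_decay h1 hu hρ).div_const ρ).indicator measurableSet_Ioi))
          fun τ => growth_mul_decay_le hu hρ τ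
    _ = 2 * (u ^ (-(α + 1)) / ((α + 1) * ρ)) + u ^ (-α) / (α * ρ) / ρ := by
        rw [integral_add (integrable_decay h2 hu hρ)
            (((integrable_decay h1 hu hρ).div_const ρ).indicator measurableSet_Ioi),
          integral_decay h2 hu hρ, integral_indicator measurableSet_Ioi, integral_div,
          (integral_Ioi_decay h1 hu hρ le_rfl).2]
        simp [decay]
    _ ≤ decayConst u ρ α := by
        have hx : u ^ (-α) ≤ u ^ (-(α + 1)) :=
          Real.rpow_le_rpow_of_exponent_ge hu hu1 (by linarith)
        have hp : 0 < u ^ (-(α + 1)) := Real.rpow_pos_of_pos hu _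
        have h3 : 2 * (u ^ (-(α + 1)) / ((α + 1) * ρ)) ≤ u ^ (-(α + 1)) / (α * ρ) := by
          rw [mul_div_assoc', div_le_div_iff₀ (by positivity) (by positivity)]
          nlinarith [mul_nonneg (mul_pos hp hρ).le (sub_nonneg.2 hα1)]
        have h4 : u ^ (-α) / (α * ρ) / ρ ≤ u ^ (-(α + 1)) / (α * ρ) / ρ := by gcongr
        have h5 : decayConst u ρ α =
            u ^ (-(α + 1)) / (α * ρ) + u ^ (-(α + 1)) / (α * ρ) / ρ := by
          unfold decayConst
          field_simp
        linarith

end Decay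

section DoubleIntegral

variable {E : Type*} [NormedAddCommGroup E] {u ρ α M : ℝ} {G : ℝ → E}

lemma integrable_of_norm_le_growth_mul_decay (hα0 : 0 < α) (hu : 0 < u)
    (hρ : 0 < ρ) (hG : Continuous G)
    (hb : ∀ τ, ‖G τ‖ ≤ M * (growth τ * decay u ρ (α + 2) τ)) : Integrable G := by
  refine Integrable.mono' (Integrable.const_mul ?_ M) hG.aestronglyMeasurable
    (Eventually.of_forall hb)
  simpa [add_assoc, one_add_one_eq_two] using
    integrable_growth_mul_decay (a := α + 1) (by linarith) hu hρ

lemma integrableOn_Iic_of_continuous {H : ℝ → E} (hH : Continuous H)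
    (h0 : IntegrableOn H (Iic 0)) (t : ℝ) : IntegrableOn H (Iic t) := by
  refine (h0.union (hH.integrableOn_Icc (a := 0) (b := t))).mono_set fun τ hτ => ?_
  rcases le_total τ 0 with h | h
  · exact Or.inl h
  · exact Or.inr ⟨h, hτ⟩

variable [NormedSpace ℝ E]

lemma norm_integral_Iic_le (hα0 : 0 < α) (hα1 : α ≤ 1) (hu : 0 < u) (hu1 : u ≤ 1)
    (hρ : 0 < ρ) (hM : 0 ≤ M)
    (hb : ∀ τ, ‖G τ‖ ≤ M * (growth τ * decay u ρ (α + 2) τ)) (σ : ℝ) :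
    ‖∫ τ in Iic σ, G τ‖ ≤ M * decayConst u ρ α := by
  have hi : Integrable fun τ => growth τ * decay u ρ (α + 2) τ := by
    simpa [add_assoc, one_add_one_eq_two] using
      integrable_growth_mul_decay (a := α + 1) (by linarith) hu hρ
  calc ‖∫ τ in Iic σ, G τ‖ ≤ ∫ τ in Iic σ, M * (growth τ * decay u ρ (α + 2) τ) :=
        norm_integral_le_of_norm_le (hi.const_mul M).integrableOn (Eventually.of_forall hb)
    _ ≤ ∫ τ, M * (growth τ * decay u ρ (α + 2) τ) :=
        setIntegral_le_integral (hi.const_mul M) (Eventually.of_forall fun τ =>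
          mul_nonneg hM (mul_pos (growth_pos τ) (decay_pos hu hρ τ)).le)
    _ ≤ M * decayConst u ρ α := by
        rw [integral_const_mul]
        exact mul_le_mul_of_nonneg_left (integral_growth_mul_decay_le hα0 hα1 hu hu1 hρ) hM

lemma norm_integral_Iic_le_decay (hα0 : 0 < α) (hu : 0 < u)
    (hρ : 0 < ρ)
    (hb : ∀ τ, ‖G τ‖ ≤ M * (growth τ * decay u ρ (α + 2) τ)) {σ : ℝ} (hσ : σ ≤ 0) :
    ‖∫ τ in Iic σ, G τ‖ ≤ M * (decay u ρ (α + 1) σ / ((α + 1) * ρ)) := by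
  obtain ⟨hi, he⟩ := integral_Iic_decay (a := α + 2) (by linarith) hu hρ hσ
  have e : α + 2 - 1 = α + 1 := by ring
  rw [e] at he
  rw [← he, ← integral_const_mul]
  refine norm_integral_le_of_norm_le (hi.const_mul M) ?_
  filter_upwards [ae_restrict_mem measurableSet_Iic] with τ hτ
  have hm : max τ 0 = 0 := max_eq_right (le_trans hτ hσ)
  simpa [growth, hm] using hb τ

lemma continuous_integral_Iic (hG : Integrable G) : Continuous fun σ => ∫ τ in Iic σ, G τ := by
  have h : (fun σ => ∫ τ in Iic σ, G τ) =
      fun σ => (∫ τ in Iic (0 : ℝ), G τ) + ∫ τ in (0 : ℝ)..σ, G τ := by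
    funext σ
    rw [← intervalIntegral.integral_Iic_sub_Iic hG.integrableOn hG.integrableOn]
    abel
  rw [h]
  exact continuous_const.add
    (intervalIntegral.continuous_primitive (fun a b => hG.intervalIntegrable) 0)

lemma integrableOn_integral_Iic (hα0 : 0 < α) (hu : 0 < u)
    (hρ : 0 < ρ) (hG : Continuous G)
    (hb : ∀ τ, ‖G τ‖ ≤ M * (growth τ * decay u ρ (α + 2) τ)) (t : ℝ) :
    IntegrableOn (fun σ => ∫ τ in Iic σ, G τ) (Iic t) := by
  have hGi := integrable_of_norm_le_growth_mul_decay hα0 hu hρ hG hb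
  have hc := continuous_integral_Iic hGi
  refine integrableOn_Iic_of_continuous hc ?_ t
  refine Integrable.mono'
    (((integral_Iic_decay (a := α + 1) (by linarith) hu hρ le_rfl).1.div_const
      ((α + 1) * ρ)).const_mul M) hc.aestronglyMeasurable ?_
  filter_upwards [ae_restrict_mem measurableSet_Iic] with σ hσ
  exact norm_integral_Iic_le_decay hα0 hu hρ hb hσ

lemma continuous_integral_Iic_integral_Iic (hα0 : 0 < α) (hu : 0 < u)
    (hρ : 0 < ρ) (hG : Continuous G)
    (hb : ∀ τ, ‖G τ‖ ≤ M * (growth τ * decay u ρ (α + 2) τ)) :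
    Continuous fun t => ∫ σ in Iic t, ∫ τ in Iic σ, G τ := by
  have hc := continuous_integral_Iic (integrable_of_norm_le_growth_mul_decay hα0 hu hρ hG hb)
  have hi := integrableOn_integral_Iic hα0 hu hρ hG hb
  have h : (fun t => ∫ σ in Iic t, ∫ τ in Iic σ, G τ) =
      fun t => (∫ σ in Iic (0 : ℝ), ∫ τ in Iic σ, G τ) +
        ∫ σ in (0 : ℝ)..t, ∫ τ in Iic σ, G τ := by
    funext t
    rw [← intervalIntegral.integral_Iic_sub_Iic (hi 0) (hi t)]
    abel
  rw [h]
  exact continuous_const.add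
    (intervalIntegral.continuous_primitive (fun a b => hc.intervalIntegrable a b) 0)

lemma norm_integral_Iic_integral_Iic_le (hα0 : 0 < α) (hα1 : α ≤ 1) (hu : 0 < u) (hu1 : u ≤ 1)
    (hρ : 0 < ρ) (hM : 0 ≤ M) (hG : Continuous G)
    (hb : ∀ τ, ‖G τ‖ ≤ M * (growth τ * decay u ρ (α + 2) τ)) (t : ℝ) :
    ‖∫ σ in Iic t, ∫ τ in Iic σ, G τ‖ ≤ M * decayConst u ρ α * growth t := by
  have hneg : ∀ t ≤ 0, ‖∫ σ in Iic t, ∫ τ in Iic σ, G τ‖ ≤ M * decayConst u ρ α := by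
    intro t ht
    obtain ⟨hi, he⟩ := integral_Iic_decay (a := α + 1) (by linarith) hu hρ ht
    have h1 : ‖∫ σ in Iic t, ∫ τ in Iic σ, G τ‖ ≤
        ∫ σ in Iic t, M * (decay u ρ (α + 1) σ / ((α + 1) * ρ)) := by
      refine norm_integral_le_of_norm_le ((hi.div_const _).const_mul M) ?_
      filter_upwards [ae_restrict_mem measurableSet_Iic] with σ hσ
      exact norm_integral_Iic_le_decay hα0 hu hρ hb (le_trans hσ ht)
    refine h1.trans ?_
    rw [integral_const_mul, integral_div, he]
    refine mul_le_mul_of_nonneg_left ?_ hM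
    rw [add_sub_cancel_right]
    have hd : decay u ρ α t ≤ u ^ (-(α + 1)) := by
      calc decay u ρ α t ≤ u ^ (-α) :=
            Real.rpow_le_rpow_of_nonpos hu (by nlinarith [abs_nonneg t]) (by linarith)
        _ ≤ u ^ (-(α + 1)) := Real.rpow_le_rpow_of_exponent_ge hu hu1 (by linarith)
    have hp : 0 < u ^ (-(α + 1)) := Real.rpow_pos_of_pos hu _
    calc decay u ρ α t / (α * ρ) / ((α + 1) * ρ)
        ≤ u ^ (-(α + 1)) / (α * ρ) / (1 * ρ) := by gcongr; linarith
      _ ≤ decayConst u ρ α := by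
        have h5 : decayConst u ρ α =
            u ^ (-(α + 1)) / (α * ρ) + u ^ (-(α + 1)) / (α * ρ) / ρ := by
          unfold decayConst
          field_simp
        have h6 : 0 ≤ u ^ (-(α + 1)) / (α * ρ) := by positivity
        rw [h5, one_mul]
        linarith
  rcases le_total t 0 with ht | ht
  · simpa [growth, max_eq_right ht] using hneg t ht
  · have hi := integrableOn_integral_Iic hα0 hu hρ hG hb
    have h1 : ∫ σ in Iic t, ∫ τ in Iic σ, G τ = (∫ σ in Iic (0 : ℝ), ∫ τ in Iic σ, G τ) +
        ∫ σ in (0 : ℝ)..t, ∫ τ in Iic σ, G τ := by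
      rw [← intervalIntegral.integral_Iic_sub_Iic (hi 0) (hi t)]
      abel
    have h2 : ‖∫ σ in (0 : ℝ)..t, ∫ τ in Iic σ, G τ‖ ≤ M * decayConst u ρ α * |t - 0| :=
      intervalIntegral.norm_integral_le_of_norm_le_const fun σ _ =>
        norm_integral_Iic_le hα0 hα1 hu hu1 hρ hM hb σ
    rw [sub_zero, abs_of_nonneg ht] at h2
    rw [h1, growth, max_eq_left ht]
    linarith [norm_add_le (∫ σ in Iic (0 : ℝ), ∫ τ in Iic σ, G τ)
      (∫ σ in (0 : ℝ)..t, ∫ τ in Iic σ, G τ), hneg 0 le_rfl]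

end DoubleIntegral

section FixedPoint

lemma exists_fixedPoint_of_weighted_contraction {E : Type*} [NormedAddCommGroup E]
    [NormedSpace ℝ E] [CompleteSpace E] {w : ℝ → ℝ} (hw : Continuous w) (hw0 : ∀ t, 0 < w t)
    {r : ℝ} (hr : 0 ≤ r) (A : (ℝ → E) → ℝ → E)
    (hmaps : ∀ f, Continuous f → (∀ t, ‖f t‖ ≤ r * w t) →
      Continuous (A f) ∧ ∀ t, ‖A f t‖ ≤ r * w t)
    (hcontr : ∀ f g, Continuous f → (∀ t, ‖f t‖ ≤ r * w t) →
      Continuous g → (∀ t, ‖g t‖ ≤ r * w t) → ∀ δ, 0 ≤ δ → (∀ t, ‖f t - g t‖ ≤ δ * w t) →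
      ∀ t, ‖A f t - A g t‖ ≤ δ / 2 * w t) :
    ∃ f, (Continuous f ∧ ∀ t, ‖f t‖ ≤ r * w t) ∧ A f = f ∧
      ∀ g, Continuous g → (∀ t, ‖g t‖ ≤ r * w t) → A g = g → g = f := by
  let S : Set (BoundedContinuousFunction ℝ E) := Metric.closedBall 0 r
  have hS : ∀ φ : S, ∀ t, ‖φ.1 t‖ ≤ r := fun φ t =>
    (φ.1.norm_coe_le_norm t).trans (mem_closedBall_zero_iff.1 φ.2)
  let up : S → ℝ → E := fun φ t => w t • φ.1 t
  have hupc : ∀ φ, Continuous (up φ) := fun φ => hw.smul φ.1.continuous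
  have hupb : ∀ φ t, ‖up φ t‖ ≤ r * w t := fun φ t => by
    simp only [up, norm_smul, Real.norm_of_nonneg (hw0 t).le]
    rw [mul_comm]
    exact mul_le_mul_of_nonneg_right (hS φ t) (hw0 t).le
  have hdown : ∀ f : ℝ → E, (∀ t, ‖f t‖ ≤ r * w t) → ∀ t, ‖(w t)⁻¹ • f t‖ ≤ r := fun f hf t => by
    rw [norm_smul, norm_inv, Real.norm_of_nonneg (hw0 t).le, inv_mul_le_iff₀ (hw0 t), mul_comm]
    exact hf t
  let down : ∀ f : ℝ → E, Continuous f → (∀ t, ‖f t‖ ≤ r * w t) → S := fun f hc hf =>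
    ⟨BoundedContinuousFunction.ofNormedAddCommGroup (fun t => (w t)⁻¹ • f t)
      ((hw.inv₀ fun t => (hw0 t).ne').smul hc) r (hdown f hf),
      mem_closedBall_zero_iff.2
        (BoundedContinuousFunction.norm_ofNormedAddCommGroup_le _ hr (hdown f hf))⟩
  have hdown_apply : ∀ f hc hf t, (down f hc hf).1 t = (w t)⁻¹ • f t := fun _ _ _ _ => rfl
  have hud : ∀ f hc hf, up (down f hc hf) = f := fun f hc hf => by
    funext t
    simp only [up, hdown_apply, smul_smul, mul_inv_cancel₀ (hw0 t).ne', one_smul]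
  let T : S → S := fun φ =>
    down (A (up φ)) (hmaps _ (hupc φ) (hupb φ)).1 (hmaps _ (hupc φ) (hupb φ)).2
  have hT : ContractingWith (1 / 2 : NNReal) T := by
    refine ⟨by rw [← NNReal.coe_lt_coe]; norm_num, LipschitzWith.of_dist_le_mul fun φ ψ => ?_⟩
    have hd : ∀ t, ‖up φ t - up ψ t‖ ≤ dist φ ψ * w t := fun t => by
      simp only [up, ← smul_sub, norm_smul, Real.norm_of_nonneg (hw0 t).le]
      rw [mul_comm, ← dist_eq_norm]
      exact mul_le_mul_of_nonneg_right (BoundedContinuousFunction.dist_coe_le_dist t) (hw0 t).le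
    have hA := hcontr _ _ (hupc φ) (hupb φ) (hupc ψ) (hupb ψ) _ dist_nonneg hd
    rw [Subtype.dist_eq, BoundedContinuousFunction.dist_le (by positivity)]
    intro t
    simp only [T, hdown_apply]
    rw [dist_eq_norm, ← smul_sub, norm_smul, norm_inv, Real.norm_of_nonneg (hw0 t).le,
      inv_mul_le_iff₀ (hw0 t)]
    refine (hA t).trans (le_of_eq ?_)
    push_cast
    ring
  have : CompleteSpace S := Metric.isClosed_closedBall.completeSpace_coe
  have : Nonempty S := ⟨⟨0, Metric.mem_closedBall_self hr⟩⟩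
  have hfix : T (ContractingWith.fixedPoint T hT) = _ := hT.fixedPoint_isFixedPt
  refine ⟨up (ContractingWith.fixedPoint T hT), ⟨hupc _, hupb _⟩, ?_, fun g hc hg hAg => ?_⟩
  · conv_rhs => rw [← hfix]
    exact (hud _ (hmaps _ (hupc _) (hupb _)).1 (hmaps _ (hupc _) (hupb _)).2).symm
  · have hgf : Function.IsFixedPt T (down g hc hg) := by
      refine Subtype.ext (BoundedContinuousFunction.ext fun t => ?_)
      simp only [T, hdown_apply, hud, hAg]
    rw [← hT.fixedPoint_unique hgf, hud g hc hg]

end FixedPoint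

section MemM

lemma MemM.norm_le {r : ℝ} {f : ℝ → Euc n} (hf : MemM r f) (t : ℝ) : ‖f t‖ ≤ r * growth t := by
  obtain ⟨-, h1, h2, h3⟩ := hf
  have p1 : 0 ≤ sSup ((fun t => ‖f t‖) '' Iic 0) := by
    refine Real.sSup_nonneg ?_
    rintro _ ⟨t, -, rfl⟩
    exact norm_nonneg _
  have p2 : 0 ≤ sSup ((fun t => ‖f t‖ / (1 + t)) '' Ici 0) := by
    refine Real.sSup_nonneg ?_
    rintro _ ⟨t, ht, rfl⟩
    have : (0 : ℝ) ≤ t := ht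
    positivity
  unfold Mnorm at h3
  rcases le_total t 0 with ht | ht
  · have := le_csSup h1 (mem_image_of_mem _ (mem_Iic.2 ht))
    rw [growth, max_eq_right ht]
    linarith
  · have := le_csSup h2 (mem_image_of_mem _ (mem_Ici.2 ht))
    rw [growth, max_eq_left ht, ← div_le_iff₀ (by linarith)]
    linarith

lemma memM_of_norm_le {r : ℝ} {f : ℝ → Euc n} (hc : Continuous f)
    (hf : ∀ t, ‖f t‖ ≤ r / 2 * growth t) : MemM r f := by
  have h1 : ∀ y ∈ (fun t => ‖f t‖) '' Iic 0, y ≤ r / 2 := by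
    rintro _ ⟨t, ht, rfl⟩
    simpa [growth, max_eq_right (mem_Iic.1 ht)] using hf t
  have h2 : ∀ y ∈ (fun t => ‖f t‖ / (1 + t)) '' Ici 0, y ≤ r / 2 := by
    rintro _ ⟨t, ht, rfl⟩
    have ht' : (0 : ℝ) ≤ t := ht
    have := hf t
    rw [growth, max_eq_left ht'] at this
    exact (div_le_iff₀ (by linarith)).2 this
  refine ⟨hc, ⟨_, h1⟩, ⟨_, h2⟩, ?_⟩
  have e1 := csSup_le (nonempty_Iic.image _) h1
  have e2 := csSup_le (nonempty_Ici.image _) h2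
  unfold Mnorm
  linarith

end MemM

section Gradient

lemma continuous_gradient {V : Euc n → ℝ} (hV : ContDiff ℝ 2 V) : Continuous (gradient V) := by
  unfold gradient
  exact (LinearIsometryEquiv.continuous _).comp (hV.continuous_fderiv (by norm_num))

lemma norm_gradient_sub_le {V : Euc n → ℝ} (hV : ContDiff ℝ 2 V) {K : Set (Euc n)}
    (hK : Convex ℝ K) {c : ℝ} (hc : ∀ p ∈ K, ‖iteratedFDeriv ℝ 2 V p‖ ≤ c) {p q : Euc n}
    (hp : p ∈ K) (hq : q ∈ K) : ‖gradient V p - gradient V q‖ ≤ c * ‖p - q‖ := by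
  have h1 : ‖fderiv ℝ V p - fderiv ℝ V q‖ ≤ c * ‖p - q‖ := by
    refine Convex.norm_image_sub_le_of_norm_fderiv_le (𝕜 := ℝ) (s := K) (fun y _ => ?_)
      (fun y hy => ?_) hK hq hp
    · exact ((hV.fderiv_right (m := 1) (by norm_num)).differentiable (by norm_num)) y
    · rw [← norm_iteratedFDeriv_one, norm_iteratedFDeriv_fderiv]
      exact hc y hy
  unfold gradient
  rwa [← map_sub, LinearIsometryEquiv.norm_map]

lemma rpow_neg_le_decay {u ρ a a' τ : ℝ} (hu : 0 < u) (hρ : 0 < ρ) (ha : 0 ≤ a) (haa : a ≤ a')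
    {p : Euc n} (hp : u + ρ * |τ| ≤ 1 + ‖p‖) : (1 + ‖p‖) ^ (-a') ≤ decay u ρ a τ :=
  calc (1 + ‖p‖) ^ (-a') ≤ (1 + ‖p‖) ^ (-a) :=
        Real.rpow_le_rpow_of_exponent_le (by linarith [norm_nonneg p]) (by linarith)
    _ ≤ decay u ρ a τ :=
        Real.rpow_le_rpow_of_nonpos (decay_base_pos hu hρ τ) hp (by linarith)

end Gradient

section Tube

/-- the points whose component along `θ` stays close to `τ s`. -/
def tube (θ : Euc n) (s r τ : ℝ) : Set (Euc n) :=
  {p | |⟪θ, p⟫ - τ * s| ≤ s / 2 * |τ| + r * growth τ}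

variable {θ : Euc n} {s r : ℝ}

lemma convex_tube (τ : ℝ) : Convex ℝ (tube θ s r τ) := by
  have h : tube θ s r τ = (innerSL ℝ θ) ⁻¹'
      Metric.closedBall (τ * s) (s / 2 * |τ| + r * growth τ) := by
    ext p
    simp [tube, Real.dist_eq]
  rw [h]
  exact (convex_closedBall _ _).linear_preimage (innerSL ℝ θ).toLinearMap

lemma le_of_mem_tube (hθ : ‖θ‖ = 1) (hs : 0 ≤ s) (hr : 0 ≤ r) {ρ : ℝ} (hρ : ρ + r ≤ s / 2)
    {τ : ℝ} {p : Euc n} (hp : p ∈ tube θ s r τ) : 1 - r + ρ * |τ| ≤ 1 + ‖p‖ := by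
  have h1 : |⟪θ, p⟫| ≤ ‖p‖ := by simpa [hθ] using abs_real_inner_le_norm θ p
  have h2 : |τ| * s ≤ |⟪θ, p⟫| + |⟪θ, p⟫ - τ * s| := by
    have h := abs_sub_abs_le_abs_sub (τ * s) ⟪θ, p⟫
    rw [abs_mul, abs_of_nonneg hs, abs_sub_comm] at h
    linarith
  have h3 : |⟪θ, p⟫ - τ * s| ≤ s / 2 * |τ| + r * growth τ := hp
  have h4 := mul_le_mul_of_nonneg_left (growth_le τ) hr
  nlinarith [mul_le_mul_of_nonneg_right hρ (abs_nonneg τ)]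

lemma add_mem_tube (hθ : ‖θ‖ = 1) {τ : ℝ} {x p v : Euc n} (hx : ⟪θ, x⟫ = 0)
    (hp : ‖p - τ • (s • θ)‖ ≤ s / 2 * |τ|) (hv : ‖v‖ ≤ r * growth τ) :
    p + x + v ∈ tube θ s r τ := by
  have h1 : ⟪θ, p + x + v⟫ - τ * s = ⟪θ, p - τ • (s • θ)⟫ + ⟪θ, v⟫ := by
    simp only [inner_add_right, inner_sub_right, inner_smul_right, hx,
      real_inner_self_eq_norm_sq, hθ]
    ring
  have h2 := abs_real_inner_le_norm θ (p - τ • (s • θ))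
  have h3 := abs_real_inner_le_norm θ v
  rw [hθ, one_mul] at h2 h3
  change |⟪θ, p + x + v⟫ - τ * s| ≤ _
  rw [h1]
  linarith [abs_add_le ⟪θ, p - τ • (s • θ)⟫ ⟪θ, v⟫]

end Tube

section Scattering

/-- decay estimates for the long range force `Fl` and the full force `F` along the sets `K τ`. -/
structure ForceBounds (Fl F : Euc n → Euc n) (B α u ρ : ℝ) (K : ℝ → Set (Euc n)) : Prop where
  continuous_long : Continuous Fl
  continuous_full : Continuous F
  long_sub : ∀ τ, ∀ p ∈ K τ, ∀ q ∈ K τ,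
    ‖Fl p - Fl q‖ ≤ B * decay u ρ (α + 2) τ * ‖p - q‖
  full_sub : ∀ τ, ∀ p ∈ K τ, ∀ q ∈ K τ,
    ‖F p - F q‖ ≤ 2 * B * decay u ρ (α + 2) τ * ‖p - q‖
  short : ∀ τ, ∀ p ∈ K τ, ‖F p - Fl p‖ ≤ B * decay u ρ (α + 2) τ
  full : ∀ τ, ∀ p ∈ K τ, ‖F p‖ ≤ 2 * B * decay u ρ (α + 1) τ

lemma forceBounds_of_potentials {α βl0 βl1 βl2 βs1 βs2 βs3 B u ρ : ℝ} (hα0 : 0 < α) (hu : 0 < u)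
    (hρ : 0 < ρ) (hB : 0 ≤ B) (hl1 : βl1 ≤ B) (hl2 : βl2 ≤ B) (hs2 : βs2 ≤ B) (hs3 : βs3 ≤ B)
    {Vl Vs : Euc n → ℝ}
    (hVl : LongRange α βl0 βl1 βl2 Vl) (hVs : ShortRange α βs1 βs2 βs3 Vs)
    {Fl Fs F : Euc n → Euc n} (hFl : ∀ y, Fl y = -gradient Vl y)
    (hFs : ∀ y, Fs y = -gradient Vs y) (hF : ∀ y, F y = Fl y + Fs y)
    {K : ℝ → Set (Euc n)} (hK : ∀ τ, Convex ℝ (K τ))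
    (hKb : ∀ τ, ∀ p ∈ K τ, u + ρ * |τ| ≤ 1 + ‖p‖) : ForceBounds Fl F B α u ρ K := by
  obtain ⟨hVlc, -, hVl1, hVl2⟩ := hVl
  obtain ⟨hVsc, -, hVs1, hVs2⟩ := hVs
  have eFl : Fl = fun y => -gradient Vl y := funext hFl
  have eFs : Fs = fun y => -gradient Vs y := funext hFs
  have cFl : Continuous Fl := eFl ▸ (continuous_gradient hVlc).neg
  have cFs : Continuous Fs := eFs ▸ (continuous_gradient hVsc).neg
  have bound : ∀ {β a a' τ : ℝ} {p : Euc n}, β ≤ B → 0 ≤ a → a ≤ a' → p ∈ K τ →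
      β * (1 + ‖p‖) ^ (-a') ≤ B * decay u ρ a τ := fun {β a a' τ p} hβ ha haa hp =>
    mul_le_mul hβ (rpow_neg_le_decay hu hρ ha haa (hKb τ p hp))
      (Real.rpow_nonneg (by positivity) _) hB
  have lFl : ∀ τ, ∀ p ∈ K τ, ∀ q ∈ K τ,
      ‖Fl p - Fl q‖ ≤ B * decay u ρ (α + 2) τ * ‖p - q‖ := fun τ p hp q hq => by
    rw [hFl, hFl, neg_sub_neg, norm_sub_rev]
    exact norm_gradient_sub_le hVlc (hK τ)
      (fun y hy => (hVl2 y).trans (bound hl2 (by linarith) le_rfl hy)) hp hq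
  have lFs : ∀ τ, ∀ p ∈ K τ, ∀ q ∈ K τ,
      ‖Fs p - Fs q‖ ≤ B * decay u ρ (α + 2) τ * ‖p - q‖ := fun τ p hp q hq => by
    rw [hFs, hFs, neg_sub_neg, norm_sub_rev]
    exact norm_gradient_sub_le hVsc (hK τ)
      (fun y hy => (hVs2 y).trans (bound hs3 (by linarith) (by linarith) hy)) hp hq
  refine ⟨cFl, ?_, lFl, fun τ p hp q hq => ?_, fun τ p hp => ?_, fun τ p hp => ?_⟩
  · rw [show F = fun y => Fl y + Fs y from funext hF]
    exact cFl.add cFs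
  · rw [hF, hF, add_sub_add_comm]
    linarith [norm_add_le (Fl p - Fl q) (Fs p - Fs q), lFl τ p hp q hq, lFs τ p hp q hq]
  · rw [hF, add_sub_cancel_left, hFs, norm_neg]
    exact (hVs1 p).trans (bound hs2 (by linarith) le_rfl hp)
  · have h1 := (hVl1 p).trans (bound hl1 (by linarith) le_rfl hp)
    have h2 := (hVs1 p).trans (bound (a := α + 1) hs2 (by linarith) (by linarith) hp)
    rw [hF, hFl, hFs]
    refine (norm_add_le _ _).trans ?_
    rw [norm_neg, norm_neg]
    linarith

variable {Fl F : Euc n → Euc n} {B α u ρ r : ℝ} {K : ℝ → Set (Euc n)} {zm : ℝ → Euc n}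
  {x : Euc n}

lemma ForceBounds.norm_integrand_le (H : ForceBounds Fl F B α u ρ K) (hu : 0 < u) (hρ : 0 < ρ)
    (hB : 0 ≤ B) (hr1 : r ≤ 1) (hz : ∀ τ, zm τ ∈ K τ)
    (hzv : ∀ τ v, ‖v‖ ≤ r * growth τ → zm τ + x + v ∈ K τ) {f : ℝ → Euc n}
    (hf : ∀ t, ‖f t‖ ≤ r * growth t) (τ : ℝ) :
    ‖F (zm τ + x + f τ) - Fl (zm τ)‖ ≤
      2 * B * (‖x‖ + 1) * (growth τ * decay u ρ (α + 2) τ) := by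
  have hk : 0 ≤ decay u ρ (α + 2) τ := (decay_pos hu hρ τ).le
  have hp := hzv τ (f τ) (hf τ)
  have h1 := H.short τ _ hp
  have h2 := H.long_sub τ _ hp _ (hz τ)
  have h3 : ‖zm τ + x + f τ - zm τ‖ ≤ ‖x‖ + growth τ := by
    rw [show zm τ + x + f τ - zm τ = x + f τ by abel]
    refine (norm_add_le _ _).trans (add_le_add le_rfl ((hf τ).trans ?_))
    exact mul_le_of_le_one_left (growth_pos τ).le hr1
  have h4 : 1 + (‖x‖ + growth τ) ≤ 2 * (‖x‖ + 1) * growth τ := by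
    nlinarith [one_le_growth τ, mul_nonneg (norm_nonneg x) (sub_nonneg.2 (one_le_growth τ)),
      mul_nonneg (norm_nonneg x) (growth_pos τ).le]
  calc ‖F (zm τ + x + f τ) - Fl (zm τ)‖
      ≤ ‖F (zm τ + x + f τ) - Fl (zm τ + x + f τ)‖ + ‖Fl (zm τ + x + f τ) - Fl (zm τ)‖ :=
        norm_sub_le_norm_sub_add_norm_sub _ _ _
    _ ≤ B * decay u ρ (α + 2) τ + B * decay u ρ (α + 2) τ * (‖x‖ + growth τ) :=
        add_le_add h1 (h2.trans (mul_le_mul_of_nonneg_left h3 (mul_nonneg hB hk)))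
    _ = B * decay u ρ (α + 2) τ * (1 + (‖x‖ + growth τ)) := by ring
    _ ≤ B * decay u ρ (α + 2) τ * (2 * (‖x‖ + 1) * growth τ) :=
        mul_le_mul_of_nonneg_left h4 (mul_nonneg hB hk)
    _ = _ := by ring

lemma ForceBounds.continuous_integrand (H : ForceBounds Fl F B α u ρ K) (hzc : Continuous zm)
    {f : ℝ → Euc n} (hf : Continuous f) :
    Continuous fun τ => F (zm τ + x + f τ) - Fl (zm τ) :=
  (H.continuous_full.comp ((hzc.add continuous_const).add hf)).sub (H.continuous_long.comp hzc)

lemma ForceBounds.norm_Aop_le (H : ForceBounds Fl F B α u ρ K) (hα0 : 0 < α) (hα1 : α ≤ 1)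
    (hu : 0 < u) (hu1 : u ≤ 1) (hρ : 0 < ρ)
    (hB : 0 ≤ B) (hr1 : r ≤ 1) (hzc : Continuous zm) (hz : ∀ τ, zm τ ∈ K τ)
    (hzv : ∀ τ v, ‖v‖ ≤ r * growth τ → zm τ + x + v ∈ K τ) {f : ℝ → Euc n} (hfc : Continuous f)
    (hf : ∀ t, ‖f t‖ ≤ r * growth t) (t : ℝ) :
    ‖Aop Fl F zm x f t‖ ≤ 2 * B * (‖x‖ + 1) * decayConst u ρ α * growth t :=
  norm_integral_Iic_integral_Iic_le hα0 hα1 hu hu1 hρ (by positivity)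
    (H.continuous_integrand hzc hfc) (H.norm_integrand_le hu hρ hB hr1 hz hzv hf) t

lemma ForceBounds.continuous_Aop (H : ForceBounds Fl F B α u ρ K) (hα0 : 0 < α)
    (hu : 0 < u) (hρ : 0 < ρ)
    (hB : 0 ≤ B) (hr1 : r ≤ 1) (hzc : Continuous zm) (hz : ∀ τ, zm τ ∈ K τ)
    (hzv : ∀ τ v, ‖v‖ ≤ r * growth τ → zm τ + x + v ∈ K τ) {f : ℝ → Euc n} (hfc : Continuous f)
    (hf : ∀ t, ‖f t‖ ≤ r * growth t) : Continuous (Aop Fl F zm x f) :=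
  continuous_integral_Iic_integral_Iic hα0 hu hρ
    (H.continuous_integrand hzc hfc) (H.norm_integrand_le hu hρ hB hr1 hz hzv hf)

lemma ForceBounds.norm_Aop_sub_le (H : ForceBounds Fl F B α u ρ K) (hα0 : 0 < α) (hα1 : α ≤ 1)
    (hu : 0 < u) (hu1 : u ≤ 1) (hρ : 0 < ρ)
    (hB : 0 ≤ B) (hr1 : r ≤ 1) (hzc : Continuous zm) (hz : ∀ τ, zm τ ∈ K τ)
    (hzv : ∀ τ v, ‖v‖ ≤ r * growth τ → zm τ + x + v ∈ K τ)
    {f g : ℝ → Euc n} (hfc : Continuous f) (hf : ∀ t, ‖f t‖ ≤ r * growth t)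
    (hgc : Continuous g) (hg : ∀ t, ‖g t‖ ≤ r * growth t) {δ : ℝ} (hδ : 0 ≤ δ)
    (hfg : ∀ t, ‖f t - g t‖ ≤ δ * growth t) (t : ℝ) :
    ‖Aop Fl F zm x f t - Aop Fl F zm x g t‖ ≤ 2 * B * δ * decayConst u ρ α * growth t := by
  have cf := H.continuous_integrand (x := x) hzc hfc
  have cg := H.continuous_integrand (x := x) hzc hgc
  have bf := H.norm_integrand_le hu hρ hB hr1 hz hzv hf
  have bg := H.norm_integrand_le hu hρ hB hr1 hz hzv hg
  have e : Aop Fl F zm x f t - Aop Fl F zm x g t = ∫ σ in Iic t, ∫ τ in Iic σ,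
      ((F (zm τ + x + f τ) - Fl (zm τ)) - (F (zm τ + x + g τ) - Fl (zm τ))) := by
    unfold Aop
    rw [← integral_sub (integrableOn_integral_Iic hα0 hu hρ cf bf t)
      (integrableOn_integral_Iic hα0 hu hρ cg bg t)]
    refine integral_congr_ae (Eventually.of_forall fun σ => ?_)
    exact (integral_sub
      (integrable_of_norm_le_growth_mul_decay hα0 hu hρ cf bf).integrableOn
      (integrable_of_norm_le_growth_mul_decay hα0 hu hρ cg bg).integrableOn).symm
  rw [e]
  refine norm_integral_Iic_integral_Iic_le hα0 hα1 hu hu1 hρ (by positivity) (cf.sub cg)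
    (fun τ => ?_) t
  have h1 := H.full_sub τ _ (hzv τ _ (hf τ)) _ (hzv τ _ (hg τ))
  rw [add_sub_add_left_eq_sub] at h1
  simp only [Pi.sub_apply, sub_sub_sub_cancel_right]
  have hk : 0 ≤ decay u ρ (α + 2) τ := (decay_pos hu hρ τ).le
  calc _ ≤ 2 * B * decay u ρ (α + 2) τ * ‖f τ - g τ‖ := h1
    _ ≤ 2 * B * decay u ρ (α + 2) τ * (δ * growth τ) :=
        mul_le_mul_of_nonneg_left (hfg τ) (by positivity)
    _ = _ := by ring

lemma ForceBounds.existsUnique_fixedPoint (H : ForceBounds Fl F B α u ρ K) (hα0 : 0 < α)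
    (hα1 : α ≤ 1) (hu : 0 < u) (hu1 : u ≤ 1) (hρ : 0 < ρ)
    (hB : 0 ≤ B) (hr0 : 0 ≤ r) (hr1 : r ≤ 1) (hzc : Continuous zm) (hz : ∀ τ, zm τ ∈ K τ)
    (hzv : ∀ τ v, ‖v‖ ≤ r * growth τ → zm τ + x + v ∈ K τ)
    (hsmall : 8 * B * (‖x‖ + 1) * decayConst u ρ α ≤ r) :
    ∃! y : ℝ → Euc n, MemM r y ∧ Aop Fl F zm x y = y := by
  have hκ := decayConst_pos hα0 hu hρ
  have hA : ∀ f, Continuous f → (∀ t, ‖f t‖ ≤ r * growth t) →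
      ∀ t, ‖Aop Fl F zm x f t‖ ≤ r / 2 * growth t := fun f hfc hf t =>
    (H.norm_Aop_le hα0 hα1 hu hu1 hρ hB hr1 hzc hz hzv hfc hf t).trans
      (mul_le_mul_of_nonneg_right (by linarith) (growth_pos t).le)
  have hq : 2 * B * decayConst u ρ α ≤ 1 / 2 := by
    nlinarith [mul_nonneg (mul_nonneg hB hκ.le) (norm_nonneg x), mul_nonneg hB hκ.le]
  obtain ⟨f, ⟨hfc, hf⟩, hfix, huniq⟩ := exists_fixedPoint_of_weighted_contraction
    continuous_growth growth_pos hr0 (Aop Fl F zm x)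
    (fun f hfc hf => ⟨H.continuous_Aop hα0 hu hρ hB hr1 hzc hz hzv hfc hf, fun t =>
      (hA f hfc hf t).trans (mul_le_mul_of_nonneg_right (by linarith) (growth_pos t).le)⟩)
    (fun f g hfc hf hgc hg δ hδ hfg t =>
      (H.norm_Aop_sub_le hα0 hα1 hu hu1 hρ hB hr1 hzc hz hzv hfc hf hgc hg hδ hfg t).trans
        (mul_le_mul_of_nonneg_right
          (by nlinarith [mul_le_mul_of_nonneg_right hq hδ]) (growth_pos t).le))
  refine ⟨f, ⟨memM_of_norm_le hfc fun t => ?_, hfix⟩, fun g ⟨hg, hgfix⟩ =>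
    huniq g hg.1 hg.norm_le hgfix⟩
  have := hA f hfc hf t
  rwa [hfix] at this

lemma ForceBounds.norm_integral_sub_le (H : ForceBounds Fl F B α u ρ K) (hα0 : 0 < α)
    (hα1 : α ≤ 1) (hu : 0 < u) (hu1 : u ≤ 1) (hρ : 0 < ρ) (hB : 0 ≤ B) {p q : ℝ → Euc n}
    (hpc : Continuous p) (hqc : Continuous q) (hp : ∀ τ, p τ ∈ K τ) (hq : ∀ τ, q τ ∈ K τ)
    {C D : ℝ} (hC : 0 ≤ C) (hD : 0 ≤ D) (hpq : ∀ τ, ‖p τ - q τ‖ ≤ C * |τ| + D * growth τ) :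
    ‖(∫ τ, F (p τ)) - ∫ τ, F (q τ)‖ ≤
      2 * B * (C * (2 * (u ^ (-α) / (α * ρ)) / ρ) + D * decayConst u ρ α) := by
  have hi : ∀ p : ℝ → Euc n, Continuous p → (∀ τ, p τ ∈ K τ) → Integrable fun τ => F (p τ) :=
    fun p hpc hp => Integrable.mono'
      ((integrable_decay (a := α + 1) (by linarith) hu hρ).const_mul (2 * B))
      (H.continuous_full.comp hpc).aestronglyMeasurable
      (Eventually.of_forall fun τ => H.full τ _ (hp τ))
  have h1 : Integrable fun τ => |τ| * decay u ρ (α + 2) τ := by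
    simpa [add_assoc, one_add_one_eq_two] using
      integrable_abs_mul_decay (a := α + 1) (by linarith) hu hρ
  have h2 : Integrable fun τ => growth τ * decay u ρ (α + 2) τ := by
    simpa [add_assoc, one_add_one_eq_two] using
      integrable_growth_mul_decay (a := α + 1) (by linarith) hu hρ
  have h3 : ∫ τ, |τ| * decay u ρ (α + 2) τ ≤ 2 * (u ^ (-α) / (α * ρ)) / ρ := by
    simpa [add_assoc, one_add_one_eq_two] using
      integral_abs_mul_decay_le (a := α + 1) (by linarith) hu hρ
  have h4 := integral_growth_mul_decay_le hα0 hα1 hu hu1 hρ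
  rw [← integral_sub (hi p hpc hp) (hi q hqc hq)]
  calc ‖∫ τ, (F (p τ) - F (q τ))‖
      ≤ ∫ τ, 2 * B * (C * (|τ| * decay u ρ (α + 2) τ) + D * (growth τ * decay u ρ (α + 2) τ)) := by
        refine norm_integral_le_of_norm_le
          (((h1.const_mul C).add (h2.const_mul D)).const_mul (2 * B))
          (Eventually.of_forall fun τ => ?_)
        have hk : 0 ≤ decay u ρ (α + 2) τ := (decay_pos hu hρ τ).le
        refine (H.full_sub τ _ (hp τ) _ (hq τ)).trans
          ((mul_le_mul_of_nonneg_left (hpq τ) (by positivity)).trans (le_of_eq (by ring)))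
    _ = 2 * B * (C * (∫ τ, |τ| * decay u ρ (α + 2) τ) +
          D * ∫ τ, growth τ * decay u ρ (α + 2) τ) := by
        rw [integral_const_mul, integral_add (h1.const_mul C) (h2.const_mul D),
          integral_const_mul, integral_const_mul]
    _ ≤ _ := by gcongr

end Scattering

section Constants

variable {α u ρ B N X : ℝ}

lemma decayConst_smallness {r : ℝ} (hα0 : 0 < α) (hu : 0 < u) (hu1 : u ≤ 1) (hρ : 0 < ρ)
    (hB : 0 ≤ B) (hN : 2 ≤ N) (hX : 0 ≤ X)
    (h : 4 * B * N * (X + 1) * (1 + 1 / ρ) ^ 2 ≤ α * r * ρ * u ^ (α + 2)) :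
    8 * B * (X + 1) * decayConst u ρ α ≤ r := by
  have hp : 0 < u ^ (α + 2) := Real.rpow_pos_of_pos hu _
  have h1 : u ^ (-(α + 1)) ≤ (u ^ (α + 2))⁻¹ := by
    rw [← Real.rpow_neg hu.le]
    exact Real.rpow_le_rpow_of_exponent_ge hu hu1 (by linarith)
  have hq : 0 < 1 / ρ := by positivity
  have h2 : 8 * B * (X + 1) * (1 + 1 / ρ) ≤ 4 * B * N * (X + 1) * (1 + 1 / ρ) ^ 2 := by
    have e : 4 * B * N * (X + 1) * (1 + 1 / ρ) ^ 2 =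
        (4 * B * (X + 1) * (1 + 1 / ρ)) * (N * (1 + 1 / ρ)) := by ring
    have h3 : 2 ≤ N * (1 + 1 / ρ) := by nlinarith
    rw [e]
    have h4 : 0 ≤ 4 * B * (X + 1) * (1 + 1 / ρ) := by positivity
    nlinarith
  calc 8 * B * (X + 1) * decayConst u ρ α
      = 8 * B * (X + 1) * (1 + 1 / ρ) / (α * ρ) * u ^ (-(α + 1)) := by
        unfold decayConst
        ring
    _ ≤ α * r * ρ * u ^ (α + 2) / (α * ρ) * (u ^ (α + 2))⁻¹ := by
        have h3 := h2.trans h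
        have h4 : 0 ≤ 8 * B * (X + 1) * (1 + 1 / ρ) := by positivity
        have h5 := h4.trans h3
        gcongr
    _ = r := by field_simp

lemma final_constant_le {C : ℝ} (hα0 : 0 < α) (hu : 0 < u) (hu1 : u ≤ 1) (hρ : 0 < ρ)
    (hB : 0 ≤ B) (hN : 2 ≤ N) (hX : 0 ≤ X) (hC : C ≤ 2 * N * B / (α * ρ)) :
    2 * B * (C * (2 * (u ^ (-α) / (α * ρ)) / ρ) +
        2 * B * (X + 1) * decayConst u ρ α * decayConst u ρ α) ≤
      4 * N ^ 2 * (3 * X + 5) * B ^ 2 * (1 + 1 / ρ) ^ 2 /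
        (α ^ 2 * u ^ (2 * α + 3) * ρ ^ 2) := by
  set U := u ^ (-(2 * α + 3)) with hU
  have hU0 : 0 < U := Real.rpow_pos_of_pos hu _
  have h1 : u ^ (-α) ≤ U := Real.rpow_le_rpow_of_exponent_ge hu hu1 (by linarith)
  have h2 : u ^ (-(α + 1)) * u ^ (-(α + 1)) ≤ U := by
    rw [← Real.rpow_add hu]
    exact Real.rpow_le_rpow_of_exponent_ge hu hu1 (by linarith)
  set Q := B ^ 2 * (1 + 1 / ρ) ^ 2 / (α ^ 2 * ρ ^ 2) * U with hQ
  have hQ0 : 0 ≤ Q := by positivity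
  have e : 4 * N ^ 2 * (3 * X + 5) * B ^ 2 * (1 + 1 / ρ) ^ 2 /
      (α ^ 2 * u ^ (2 * α + 3) * ρ ^ 2) = 4 * N ^ 2 * (3 * X + 5) * Q := by
    rw [hQ, hU, Real.rpow_neg hu.le]
    field_simp
  have t1 : 2 * B * (C * (2 * (u ^ (-α) / (α * ρ)) / ρ)) ≤ 4 * N * Q := by
    have hv : 2 * (1 / ρ) ≤ (1 + 1 / ρ) ^ 2 := by nlinarith [sq_nonneg (1 / ρ)]
    calc 2 * B * (C * (2 * (u ^ (-α) / (α * ρ)) / ρ))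
        ≤ 2 * B * (2 * N * B / (α * ρ) * (2 * (U / (α * ρ)) / ρ)) := by
          have : 0 ≤ u ^ (-α) := Real.rpow_nonneg hu.le _
          gcongr
      _ = 4 * N * (B ^ 2 * (2 * (1 / ρ)) / (α ^ 2 * ρ ^ 2) * U) := by
          field_simp
          ring
      _ ≤ 4 * N * Q := by
          rw [hQ]
          gcongr
  have t2 : 2 * B * (2 * B * (X + 1) * decayConst u ρ α * decayConst u ρ α) ≤
      4 * (X + 1) * Q := by
    calc 2 * B * (2 * B * (X + 1) * decayConst u ρ α * decayConst u ρ α)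
        = 4 * (X + 1) * (B ^ 2 * (1 + 1 / ρ) ^ 2 / (α ^ 2 * ρ ^ 2) *
            (u ^ (-(α + 1)) * u ^ (-(α + 1)))) := by
          unfold decayConst
          field_simp
          ring
      _ ≤ 4 * (X + 1) * Q := by
          rw [hQ]
          gcongr
  have t3 : 4 * N + 4 * (X + 1) ≤ 4 * N ^ 2 * (3 * X + 5) := by
    nlinarith [mul_nonneg (sq_nonneg N) hX, mul_nonneg (sub_nonneg.2 hN) hX]
  rw [e, mul_add]
  nlinarith [mul_le_mul_of_nonneg_right t3 hQ0]

lemma free_deviation_bounds {βl1 βl2 s r : ℝ} (hα0 : 0 < α) (hβ : 0 < βl1) (hN : 1 ≤ N)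
    (hs : Real.sqrt (2 ^ 5 * N * max βl1 βl2 / α) ≤ s) (hB : βl1 ≤ B) (hr : 0 ≤ r)
    (hρ : 0 < s / 2 ^ ((3 : ℝ) / 2) - r) :
    2 ^ ((5 : ℝ) / 2) * Real.sqrt N * βl1 / (α * s) ≤ s / 2 ∧
      2 ^ ((5 : ℝ) / 2) * Real.sqrt N * βl1 / (α * s) ≤
        2 * N * B / (α * (s / 2 ^ ((3 : ℝ) / 2) - r)) := by
  set d : ℝ := 2 ^ ((3 : ℝ) / 2) with hd
  have hd0 : 0 < d := Real.rpow_pos_of_pos two_pos _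
  have hd4 : d ≤ 4 := by
    calc d ≤ (2 : ℝ) ^ (2 : ℝ) :=
          Real.rpow_le_rpow_of_exponent_le one_le_two (by norm_num)
      _ = 4 := by norm_num
  have h5 : (2 : ℝ) ^ ((5 : ℝ) / 2) = 2 * d := by
    rw [hd, show (5 : ℝ) / 2 = 1 + 3 / 2 by norm_num, Real.rpow_add two_pos, Real.rpow_one]
  have hm : 0 < max βl1 βl2 := lt_max_of_lt_left hβ
  have hs0 : 0 < s := (Real.sqrt_pos.2 (by positivity)).trans_le hs
  have hsq : Real.sqrt N ≤ N := by
    rw [Real.sqrt_le_left (by linarith)]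
    nlinarith
  have hss : 2 ^ 5 * N * max βl1 βl2 ≤ s ^ 2 * α := by
    rw [← div_le_iff₀ hα0]
    exact (Real.sqrt_le_left hs0.le).1 hs
  have hle : 2 * d * Real.sqrt N * βl1 ≤ 2 * d * N * βl1 := by gcongr
  rw [h5]
  constructor
  · rw [div_le_div_iff₀ (by positivity) two_pos]
    have h1 : 2 * d * N * βl1 ≤ 2 * 4 * N * max βl1 βl2 := by
      gcongr
      exact le_max_left _ _
    have h2 : 0 ≤ N * max βl1 βl2 := by positivity
    nlinarith
  · have hB0 : 0 < B := hβ.trans_le hB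
    have hρs : (s / d - r) * d ≤ s := by
      rw [sub_mul, div_mul_cancel₀ _ hd0.ne']
      nlinarith
    rw [div_le_div_iff₀ (by positivity) (by positivity)]
    calc 2 * d * Real.sqrt N * βl1 * (α * (s / d - r))
        ≤ 2 * d * N * βl1 * (α * (s / d - r)) := by gcongr
      _ = 2 * N * βl1 * α * ((s / d - r) * d) := by ring
      _ ≤ 2 * N * B * α * s := by gcongr
      _ = 2 * N * B * (α * s) := by ring

end Constants

theorem statement_5
    (n : ℕ) (hn : 2 ≤ n) (α : ℝ) (hα0 : 0 < α) (hα1 : α ≤ 1)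
    (Vl Vs : Euc n → ℝ) (βl0 βl1 βl2 βs1 βs2 βs3 : ℝ)
    (hβl0 : 0 < βl0) (hβl1 : 0 < βl1) (hβl2 : 0 < βl2)
    (hβs1 : 0 < βs1) (hβs2 : 0 < βs2) (hβs3 : 0 < βs3)
    (hVl : LongRange α βl0 βl1 βl2 Vl) (hVs : ShortRange α βs1 βs2 βs3 Vs)
    (Fl Fs F : Euc n → Euc n)
    (hFl : ∀ y, Fl y = -gradient Vl y) (hFs : ∀ y, Fs y = -gradient Vs y)
    (hF : ∀ y, F y = Fl y + Fs y)
    (θ x : Euc n) (hθ : ‖θ‖ = 1) (hperp : ⟪θ, x⟫ = 0)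
    (r : ℝ) (hr0 : 0 < r) (hr1 : r < 1)
    (s : ℝ) (hsμ : Real.sqrt (2 ^ 5 * (n : ℝ) * max βl1 βl2 / α) ≤ s) (hsr : 2 ^ ((3:ℝ)/2) * r < s)
    (hcond : 4 * (max βl1 (max βl2 (max βs2 βs3))) * (n : ℝ) * (‖x‖ + 1) * (1 + 1 / (s / 2 ^ ((3:ℝ)/2) - r)) ^ 2 ≤
      α * r * (s / 2 ^ ((3:ℝ)/2) - r) * (1 - r) ^ (α + 2))
    (zm : ℝ → Euc n)
    (hzm : IsFreeSol Fl 0 (s • θ) atBot (2 ^ ((5:ℝ)/2) * Real.sqrt n * βl1 / (α * s)) zm)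
 :
    (∃! y : ℝ → Euc n, MemM r y ∧ Aop Fl F zm x y = y) ∧
    ∀ y : ℝ → Euc n, MemM r y → Aop Fl F zm x y = y →
      ‖(∫ τ : ℝ, F (zm τ + x + y τ)) - ∫ τ : ℝ, F (τ • (s • θ) + x)‖ ≤
        4 * (n : ℝ) ^ 2 * (3 * ‖x‖ + 5) * (max βl1 (max βl2 (max βs2 βs3))) ^ 2 * (1 + 1 / (s / 2 ^ ((3:ℝ)/2) - r)) ^ 2 /
          (α ^ 2 * (1 - r) ^ (2 * α + 3) * (s / 2 ^ ((3:ℝ)/2) - r) ^ 2) := by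
  set ρ : ℝ := s / 2 ^ ((3 : ℝ) / 2) - r with hρdef
  set B : ℝ := max βl1 (max βl2 (max βs2 βs3)) with hBdef
  have hl1 : βl1 ≤ B := le_max_left _ _
  have hl2 : βl2 ≤ B := (le_max_left _ _).trans (le_max_right _ _)
  have hs2 : βs2 ≤ B :=
    (le_max_left _ _).trans ((le_max_right _ _).trans (le_max_right _ _))
  have hs3 : βs3 ≤ B :=
    (le_max_right _ _).trans ((le_max_right _ _).trans (le_max_right _ _))
  have hB : 0 ≤ B := hβl1.le.trans hl1
  have hN : (2 : ℝ) ≤ n := by exact_mod_cast hn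
  have hd0 : (0 : ℝ) < 2 ^ ((3 : ℝ) / 2) := Real.rpow_pos_of_pos two_pos _
  have hd2 : (2 : ℝ) ≤ 2 ^ ((3 : ℝ) / 2) :=
    Real.self_le_rpow_of_one_le one_le_two (by norm_num)
  have hs0 : 0 < s := (mul_pos hd0 hr0).trans hsr
  have hρ : 0 < ρ := by
    rw [hρdef, sub_pos, lt_div_iff₀ hd0, mul_comm]
    exact hsr
  have hρs : ρ + r ≤ s / 2 := by
    rw [hρdef, sub_add_cancel]
    exact div_le_div_of_nonneg_left hs0.le two_pos hd2
  have hu : 0 < 1 - r := by linarith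
  have hu1 : 1 - r ≤ 1 := by linarith
  obtain ⟨hzC2, -, -, -, hzdev⟩ := hzm
  have hzc : Continuous zm := hzC2.continuous
  obtain ⟨hC1, hC2⟩ := free_deviation_bounds hα0 hβl1 (by linarith) hsμ hl1 hr0.le hρ
  set C : ℝ := 2 ^ ((5 : ℝ) / 2) * Real.sqrt n * βl1 / (α * s) with hCdef
  have hC0 : 0 ≤ C := by positivity
  have hdev : ∀ τ, ‖zm τ - τ • (s • θ)‖ ≤ C * |τ| := fun τ => by
    simpa using hzdev τ
  have hdev' : ∀ τ, ‖zm τ - τ • (s • θ)‖ ≤ s / 2 * |τ| := fun τ =>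
    (hdev τ).trans (mul_le_mul_of_nonneg_right hC1 (abs_nonneg τ))
  have hzero : ∀ τ, ‖(0 : Euc n)‖ ≤ r * growth τ := fun τ => by
    simpa using mul_nonneg hr0.le (growth_pos τ).le
  have hz : ∀ τ, zm τ ∈ tube θ s r τ := fun τ => by
    simpa using add_mem_tube (x := 0) hθ (inner_zero_right θ) (hdev' τ) (hzero τ)
  have hzv : ∀ τ v, ‖v‖ ≤ r * growth τ → zm τ + x + v ∈ tube θ s r τ := fun τ v hv =>
    add_mem_tube hθ hperp (hdev' τ) hv
  have hline : ∀ τ : ℝ, τ • (s • θ) + x ∈ tube θ s r τ := fun τ => by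
    simpa using add_mem_tube (p := τ • (s • θ)) hθ hperp
      (by simpa using mul_nonneg (half_pos hs0).le (abs_nonneg τ)) (hzero τ)
  have H : ForceBounds Fl F B α (1 - r) ρ (tube θ s r) :=
    forceBounds_of_potentials hα0 hu hρ hB hl1 hl2 hs2 hs3 hVl hVs hFl hFs hF convex_tube
      fun τ p hp => le_of_mem_tube hθ hs0.le hr0.le hρs hp
  have hsmall := decayConst_smallness hα0 hu hu1 hρ hB hN (norm_nonneg x) hcond
  refine ⟨H.existsUnique_fixedPoint hα0 hα1 hu hu1 hρ hB hr0.le hr1.le hzc hz hzv hsmall,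
    fun y hy hfix => ?_⟩
  have hyb : ∀ τ, ‖y τ‖ ≤ 2 * B * (‖x‖ + 1) * decayConst (1 - r) ρ α * growth τ := fun τ => by
    have h := H.norm_Aop_le hα0 hα1 hu hu1 hρ hB hr1.le hzc hz hzv hy.1 hy.norm_le τ
    rwa [hfix] at h
  have hκ := decayConst_pos hα0 hu hρ
  refine (H.norm_integral_sub_le hα0 hα1 hu hu1 hρ hB ((hzc.add continuous_const).add hy.1)
    (by fun_prop) (fun τ => hzv τ _ (hy.norm_le τ)) hline hC0
    (D := 2 * B * (‖x‖ + 1) * decayConst (1 - r) ρ α) (by positivity) fun τ => ?_).trans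
    (final_constant_le hα0 hu hu1 hρ hB hN (norm_nonneg x) hC2)
  change ‖zm τ + x + y τ - (τ • (s • θ) + x)‖ ≤ _
  rw [show zm τ + x + y τ - (τ • (s • θ) + x) = (zm τ - τ • (s • θ)) + y τ by abel]
  exact (norm_add_le _ _).trans (add_le_add (hdev τ) (hyb τ))

end Paper
end
end

section
/- Let θ ∈ ℝⁿ with |θ| = 1 and x ∈ ℝⁿ with θ·x = 0, and fix r ∈ (0,1). For all sufficiently large s > 0 the map A (with v_− = sθ, x_− = x) has a unique fixed point y_−^{(s)} in M_r; set a_sc(sθ,x) := ∫_{−∞}^∞ F(z_−(sθ,τ) + x + y_−^{(s)}(τ)) dτ. Then lim_{s→+∞} s·a_sc(sθ,x) = ∫_{−∞}^∞ F^l(τθ + x) dτ + ∫_{−∞}^∞ F^s(τθ + x) dτ. -/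
open MeasureTheory Real Filter Set Topology RealInnerProductSpace

noncomputable section

namespace Paper

variable {n : ℕ}

/-- The weight dominating the integrands, integrable twice from `-∞`. -/
def weight (p s t : ℝ) : ℝ := (1 + s * |t|) ^ (-p) * (1 + s * max (-t) 0) ^ (-p)

/-- The total mass of `(1 + |u|) ^ (-p)`. -/
def mass (p : ℝ) : ℝ := ∫ u : ℝ, (1 + |u|) ^ (-p)

lemma mass_nonneg (p : ℝ) : 0 ≤ mass p :=
  integral_nonneg fun u => by positivity

lemma continuous_one_add_mul_abs_rpow {s : ℝ} (hs : 0 ≤ s) (p : ℝ) :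
    Continuous fun t : ℝ => (1 + s * |t|) ^ (-p) :=
  Continuous.rpow_const (by fun_prop) fun t => Or.inl (by positivity)

lemma continuous_one_add_mul_negPart_rpow {s : ℝ} (hs : 0 ≤ s) (p : ℝ) :
    Continuous fun t : ℝ => (1 + s * max (-t) 0) ^ (-p) :=
  Continuous.rpow_const (by fun_prop) fun t => Or.inl (by positivity)

lemma integrable_one_add_abs_rpow {p : ℝ} (hp : 1 < p) :
    Integrable fun u : ℝ => (1 + |u|) ^ (-p) := by
  have := integrable_one_add_norm (E := ℝ) (μ := volume) (r := p) (by simpa using hp)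
  simpa using this

lemma integrable_one_add_mul_abs_rpow {p s : ℝ} (hp : 1 < p) (hs : 0 < s) :
    Integrable fun t : ℝ => (1 + s * |t|) ^ (-p) := by
  have := (integrable_one_add_abs_rpow hp).comp_mul_left' hs.ne'
  simpa [abs_mul, abs_of_pos hs] using this

lemma integral_one_add_mul_abs_rpow {s : ℝ} (hs : 0 < s) (p : ℝ) :
    ∫ t : ℝ, (1 + s * |t|) ^ (-p) = mass p / s := by
  have := Measure.integral_comp_mul_left (fun u : ℝ => (1 + |u|) ^ (-p)) s
  simp only [abs_mul, abs_of_pos hs, smul_eq_mul, abs_inv] at this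
  rw [this, mass, div_eq_inv_mul]

lemma weight_nonneg {s : ℝ} (hs : 0 ≤ s) (p t : ℝ) : 0 ≤ weight p s t := by
  unfold weight; positivity

lemma continuous_weight {s : ℝ} (hs : 0 ≤ s) (p : ℝ) : Continuous (weight p s) :=
  (continuous_one_add_mul_abs_rpow hs p).mul (continuous_one_add_mul_negPart_rpow hs p)

lemma rpow_mul_growth_le_weight {α s : ℝ} (hα : 0 < α) (hs : 1 ≤ s) (t : ℝ) :
    (1 + s * |t|) ^ (-(α + 2)) * growth t ≤ weight (1 + α / 2) s t := by
  have h0 : 0 ≤ s * |t| := by positivity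
  have h1 : 0 < 1 + s * |t| := by positivity
  unfold weight
  rcases le_total t 0 with ht | ht
  · rw [max_eq_left (neg_nonneg.2 ht), ← abs_of_nonpos ht, ← Real.rpow_add h1]
    simp only [growth, max_eq_right ht, add_zero, mul_one]
    exact (congrArg _ (by ring)).le
  · rw [max_eq_right (neg_nonpos.2 ht)]
    simp only [mul_zero, add_zero, Real.one_rpow, mul_one]
    have hg : growth t ≤ 1 + s * |t| := by
      have := growth_le t
      nlinarith [abs_nonneg t]
    calc (1 + s * |t|) ^ (-(α + 2)) * growth t
        ≤ (1 + s * |t|) ^ (-(α + 2)) * (1 + s * |t|) := by gcongr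
      _ = (1 + s * |t|) ^ (-(α + 2) + 1) := by rw [Real.rpow_add h1, Real.rpow_one]
      _ ≤ _ := Real.rpow_le_rpow_of_exponent_le (by linarith) (by linarith)

lemma integrable_weight {p s : ℝ} (hp : 1 < p) (hs : 0 < s) : Integrable (weight p s) := by
  refine (integrable_one_add_mul_abs_rpow hp hs).mono'
    (continuous_weight hs.le p).aestronglyMeasurable (ae_of_all _ fun t => ?_)
  rw [Real.norm_of_nonneg (weight_nonneg hs.le p t)]
  refine mul_le_of_le_one_right (by positivity) ?_
  refine Real.rpow_le_one_of_one_le_of_nonpos ?_ (by linarith)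
  have : 0 ≤ s * max (-t) 0 := by positivity
  linarith

lemma setIntegral_Iic_weight_le {p s : ℝ} (hp : 1 < p) (hs : 0 < s) (σ : ℝ) :
    ∫ τ in Iic σ, weight p s τ ≤ mass p / s * (1 + s * max (-σ) 0) ^ (-p) := by
  have hi := (integrable_one_add_mul_abs_rpow hp hs).mul_const ((1 + s * max (-σ) 0) ^ (-p))
  calc ∫ τ in Iic σ, weight p s τ
      ≤ ∫ τ in Iic σ, (1 + s * |τ|) ^ (-p) * (1 + s * max (-σ) 0) ^ (-p) := by
        refine setIntegral_mono_on (integrable_weight hp hs).integrableOn hi.integrableOn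
          measurableSet_Iic fun τ hτ => ?_
        have hτ : τ ≤ σ := hτ
        unfold weight
        refine mul_le_mul_of_nonneg_left ?_ (by positivity)
        refine Real.rpow_le_rpow_of_nonpos (by positivity) ?_ (by linarith)
        gcongr
    _ ≤ ∫ τ, (1 + s * |τ|) ^ (-p) * (1 + s * max (-σ) 0) ^ (-p) :=
        setIntegral_le_integral hi (ae_of_all _ fun τ => by positivity)
    _ = _ := by rw [integral_mul_const, integral_one_add_mul_abs_rpow hs]

lemma one_add_mul_negPart_rpow_le {p s : ℝ} (hp : 0 ≤ p) (hs : 1 ≤ s) (σ : ℝ) :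
    (1 + s * max (-σ) 0) ^ (-p) ≤ (1 + |σ|) ^ (-p) + (Ioi (0:ℝ)).indicator 1 σ := by
  rcases le_or_gt σ 0 with h | h
  · rw [indicator_of_notMem (by simpa using h), add_zero, max_eq_left (neg_nonneg.2 h),
      ← abs_of_nonpos h]
    refine Real.rpow_le_rpow_of_nonpos (by positivity) ?_ (by linarith)
    nlinarith [abs_nonneg σ]
  · rw [indicator_of_mem (by simpa using h), max_eq_right (by linarith)]
    simp
    positivity

lemma integrableOn_Iic_indicator_Ioi (t : ℝ) :
    IntegrableOn ((Ioi (0:ℝ)).indicator (1 : ℝ → ℝ)) (Iic t) := by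
  rw [IntegrableOn, integrable_indicator_iff measurableSet_Ioi]
  show Integrable (fun _ => (1:ℝ)) _
  rw [Measure.restrict_restrict measurableSet_Ioi, Ioi_inter_Iic]
  simp

lemma integrableOn_Iic_one_add_mul_negPart_rpow {p s : ℝ} (hp : 1 < p) (hs : 1 ≤ s) (t : ℝ) :
    IntegrableOn (fun σ : ℝ => (1 + s * max (-σ) 0) ^ (-p)) (Iic t) := by
  refine ((integrable_one_add_abs_rpow hp).integrableOn.add
    (integrableOn_Iic_indicator_Ioi t)).mono'
    (continuous_one_add_mul_negPart_rpow (by linarith) p).aestronglyMeasurable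
    (ae_of_all _ fun σ => ?_)
  rw [Real.norm_of_nonneg (by positivity)]
  exact one_add_mul_negPart_rpow_le (by linarith) hs σ

lemma setIntegral_Iic_one_add_mul_negPart_rpow_le {p s : ℝ} (hp : 1 < p) (hs : 1 ≤ s) (t : ℝ) :
    ∫ σ in Iic t, (1 + s * max (-σ) 0) ^ (-p) ≤ (mass p + 1) * growth t := by
  have hi := integrable_one_add_abs_rpow hp
  calc ∫ σ in Iic t, (1 + s * max (-σ) 0) ^ (-p)
      ≤ ∫ σ in Iic t, ((1 + |σ|) ^ (-p) + (Ioi (0:ℝ)).indicator 1 σ) :=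
        setIntegral_mono (integrableOn_Iic_one_add_mul_negPart_rpow hp hs t)
          (hi.integrableOn.add (integrableOn_Iic_indicator_Ioi t))
          (one_add_mul_negPart_rpow_le (by linarith) hs)
    _ = (∫ σ in Iic t, (1 + |σ|) ^ (-p)) + ∫ σ in Iic t, (Ioi (0:ℝ)).indicator 1 σ :=
        integral_add hi.integrableOn (integrableOn_Iic_indicator_Ioi t)
    _ ≤ mass p + max t 0 := by
        gcongr
        · exact setIntegral_le_integral hi (ae_of_all _ fun τ => by positivity)
        · rw [integral_indicator_one measurableSet_Ioi, measureReal_restrict_apply measurableSet_Ioi,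
            Ioi_inter_Iic, Real.volume_real_Ioc]
          simp
    _ ≤ (mass p + 1) * growth t := by
        have := mass_nonneg p
        have : 0 ≤ max t 0 := le_max_right _ _
        unfold growth
        nlinarith

lemma continuous_setIntegral_Iic {E : Type*} [NormedAddCommGroup E] [NormedSpace ℝ E]
    {h : ℝ → E} (hi : ∀ t, IntegrableOn h (Iic t)) :
    Continuous fun t => ∫ τ in Iic t, h τ := by
  have hint : ∀ a b, IntervalIntegrable h volume a b := fun a b =>
    ⟨(hi b).mono_set Ioc_subset_Iic_self, (hi a).mono_set Ioc_subset_Iic_self⟩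
  have : (fun t => ∫ τ in Iic t, h τ) =
      fun t => (∫ τ in Iic (0:ℝ), h τ) + ∫ τ in (0:ℝ)..t, h τ := by
    funext t
    rw [← intervalIntegral.integral_Iic_sub_Iic (hi 0) (hi t)]
    abel
  rw [this]
  exact continuous_const.add (intervalIntegral.continuous_primitive hint 0)

/-- The second iterated primitive vanishing at `-∞`. -/
def doubleIntegral (h : ℝ → Euc n) (t : ℝ) : Euc n := ∫ σ in Iic t, ∫ τ in Iic σ, h τ

section DoubleIntegral

variable {p s B : ℝ} {h : ℝ → Euc n}

lemma integrable_of_le_weight (hp : 1 < p) (hs : 1 ≤ s) (hc : Continuous h)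
    (hb : ∀ τ, ‖h τ‖ ≤ B * weight p s τ) : Integrable h :=
  ((integrable_weight hp (by linarith)).const_mul B).mono' hc.aestronglyMeasurable
    (ae_of_all _ hb)

lemma norm_setIntegral_Iic_le (hp : 1 < p) (hs : 1 ≤ s) (hB : 0 ≤ B)
    (hb : ∀ τ, ‖h τ‖ ≤ B * weight p s τ) (σ : ℝ) :
    ‖∫ τ in Iic σ, h τ‖ ≤ B * (mass p / s) * (1 + s * max (-σ) 0) ^ (-p) := by
  have hs0 : 0 < s := by linarith
  calc ‖∫ τ in Iic σ, h τ‖ ≤ ∫ τ in Iic σ, B * weight p s τ :=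
        norm_integral_le_of_norm_le ((integrable_weight hp hs0).const_mul B).integrableOn
          (ae_of_all _ hb)
    _ = B * ∫ τ in Iic σ, weight p s τ := integral_const_mul _ _
    _ ≤ B * (mass p / s * (1 + s * max (-σ) 0) ^ (-p)) := by
        gcongr
        exact setIntegral_Iic_weight_le hp hs0 σ
    _ = _ := by ring

lemma integrableOn_setIntegral_Iic (hp : 1 < p) (hs : 1 ≤ s) (hB : 0 ≤ B) (hc : Continuous h)
    (hb : ∀ τ, ‖h τ‖ ≤ B * weight p s τ) (t : ℝ) :
    IntegrableOn (fun σ => ∫ τ in Iic σ, h τ) (Iic t) :=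
  ((integrableOn_Iic_one_add_mul_negPart_rpow hp hs t).const_mul (B * (mass p / s))).mono'
    (continuous_setIntegral_Iic fun _ =>
      (integrable_of_le_weight hp hs hc hb).integrableOn).aestronglyMeasurable
    (ae_of_all _ (norm_setIntegral_Iic_le hp hs hB hb))

lemma continuous_doubleIntegral (hp : 1 < p) (hs : 1 ≤ s) (hB : 0 ≤ B) (hc : Continuous h)
    (hb : ∀ τ, ‖h τ‖ ≤ B * weight p s τ) : Continuous (doubleIntegral h) :=
  continuous_setIntegral_Iic (integrableOn_setIntegral_Iic hp hs hB hc hb)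

lemma norm_doubleIntegral_le (hp : 1 < p) (hs : 1 ≤ s) (hB : 0 ≤ B)
    (hb : ∀ τ, ‖h τ‖ ≤ B * weight p s τ) (t : ℝ) :
    ‖doubleIntegral h t‖ ≤ B * (mass p * (mass p + 1)) / s * growth t := by
  have hm := mass_nonneg p
  calc ‖doubleIntegral h t‖
      ≤ ∫ σ in Iic t, B * (mass p / s) * (1 + s * max (-σ) 0) ^ (-p) :=
        norm_integral_le_of_norm_le
          ((integrableOn_Iic_one_add_mul_negPart_rpow hp hs t).const_mul _)
          (ae_of_all _ (norm_setIntegral_Iic_le hp hs hB hb))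
    _ = B * (mass p / s) * ∫ σ in Iic t, (1 + s * max (-σ) 0) ^ (-p) := integral_const_mul _ _
    _ ≤ B * (mass p / s) * ((mass p + 1) * growth t) := by
        gcongr
        exact setIntegral_Iic_one_add_mul_negPart_rpow_le hp hs t
    _ = _ := by ring

lemma doubleIntegral_sub (hp : 1 < p) (hs : 1 ≤ s) (hB : 0 ≤ B) {g : ℝ → Euc n}
    (hch : Continuous h) (hcg : Continuous g) (hbh : ∀ τ, ‖h τ‖ ≤ B * weight p s τ)
    (hbg : ∀ τ, ‖g τ‖ ≤ B * weight p s τ) (t : ℝ) :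
    doubleIntegral (fun τ => h τ - g τ) t = doubleIntegral h t - doubleIntegral g t := by
  unfold doubleIntegral
  rw [← integral_sub (integrableOn_setIntegral_Iic hp hs hB hch hbh t)
    (integrableOn_setIntegral_Iic hp hs hB hcg hbg t)]
  congr 1
  funext σ
  exact integral_sub (integrable_of_le_weight hp hs hch hbh).integrableOn
    (integrable_of_le_weight hp hs hcg hbg).integrableOn

end DoubleIntegral

open BoundedContinuousFunction in
lemma exists_fixedPoint_of_contracting {r : ℝ} (hr : 0 < r) (T : (ℝ → Euc n) → ℝ → Euc n)
    (hcont : ∀ f, Continuous f → (∀ t, ‖f t‖ ≤ r * growth t) → Continuous (T f))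
    (hbd : ∀ f, Continuous f → (∀ t, ‖f t‖ ≤ r * growth t) → ∀ t, ‖T f t‖ ≤ r / 2 * growth t)
    (hlip : ∀ f g, Continuous f → Continuous g → (∀ t, ‖f t‖ ≤ r * growth t) →
      (∀ t, ‖g t‖ ≤ r * growth t) → ∀ d, 0 ≤ d → (∀ t, ‖f t - g t‖ ≤ d * growth t) →
      ∀ t, ‖T f t - T g t‖ ≤ d / 2 * growth t) :
    ∃ y, MemM r y ∧ T y = y := by
  let S := Metric.closedBall (0 : ℝ →ᵇ Euc n) r
  let up : S → ℝ → Euc n := fun g t => growth t • g.1 t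
  have up_cont : ∀ g, Continuous (up g) := fun g => continuous_growth.smul g.1.continuous
  have up_le : ∀ g t, ‖up g t‖ ≤ r * growth t := fun g t => by
    have h1 : ‖g.1‖ ≤ r := mem_closedBall_zero_iff.1 g.2
    have h2 := (g.1.norm_coe_le_norm t).trans h1
    simp only [up, norm_smul, Real.norm_of_nonneg (growth_pos t).le]
    rw [mul_comm]
    have := growth_pos t
    gcongr
  have scale_le : ∀ {v : Euc n} {c t : ℝ}, ‖v‖ ≤ c * growth t → ‖(growth t)⁻¹ • v‖ ≤ c := by
    intro v c t h
    rw [norm_smul, norm_inv, Real.norm_of_nonneg (growth_pos t).le, inv_mul_le_iff₀ (growth_pos t)]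
    linarith
  let low : S → ℝ →ᵇ Euc n := fun g =>
    BoundedContinuousFunction.ofNormedAddCommGroup (fun t => (growth t)⁻¹ • T (up g) t)
      ((continuous_growth.inv₀ fun t => (growth_pos t).ne').smul
        (hcont _ (up_cont g) (up_le g))) (r / 2)
      fun t => scale_le (hbd _ (up_cont g) (up_le g) t)
  have low_apply : ∀ g t, low g t = (growth t)⁻¹ • T (up g) t := fun _ _ => rfl
  have low_mem : ∀ g, low g ∈ S := fun g => by
    have : ‖low g‖ ≤ r / 2 :=
      BoundedContinuousFunction.norm_ofNormedAddCommGroup_le _ (by linarith) _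
    simp only [S, mem_closedBall_zero_iff]
    linarith
  let Φ : S → S := fun g => ⟨low g, low_mem g⟩
  have hΦ : ContractingWith (1 / 2) Φ := by
    refine ⟨by norm_num [← NNReal.coe_lt_coe], LipschitzWith.of_dist_le_mul fun g g' => ?_⟩
    rw [Subtype.dist_eq, Subtype.dist_eq]
    change dist (low g) (low g') ≤ _
    rw [BoundedContinuousFunction.dist_le (by positivity)]
    intro t
    rw [low_apply, low_apply, dist_eq_norm, ← smul_sub]
    refine scale_le ((hlip _ _ (up_cont g) (up_cont g') (up_le g) (up_le g') (dist g.1 g'.1)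
      dist_nonneg (fun u => ?_) t).trans_eq ?_)
    · simp only [up]
      rw [← smul_sub, norm_smul, Real.norm_of_nonneg (growth_pos u).le, mul_comm, ← dist_eq_norm]
      have := growth_pos u
      gcongr
      exact BoundedContinuousFunction.dist_coe_le_dist u
    · rw [NNReal.coe_div, NNReal.coe_one, NNReal.coe_two]
      ring
  have : Nonempty S := ⟨⟨0, by simp [S, hr.le]⟩⟩
  have : CompleteSpace S := Metric.isClosed_closedBall.completeSpace_coe
  obtain ⟨g, hg⟩ : ∃ g, Φ g = g := ⟨_, hΦ.fixedPoint_isFixedPt⟩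
  have hfix : T (up g) = up g := by
    funext t
    have h1 : low g t = g.1 t := by
      have := congrArg Subtype.val hg
      exact DFunLike.congr_fun this t
    rw [low_apply] at h1
    simp only [up]
    rw [← h1, smul_inv_smul₀ (growth_pos t).ne']
  refine ⟨up g, memM_of_norm_le (up_cont g) fun t => ?_, hfix⟩
  have := hbd _ (up_cont g) (up_le g) t
  rwa [hfix] at this

lemma fixedPoint_unique_of_contracting {r : ℝ} (hr : 0 < r) (T : (ℝ → Euc n) → ℝ → Euc n)
    (hlip : ∀ f g, Continuous f → Continuous g → (∀ t, ‖f t‖ ≤ r * growth t) →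
      (∀ t, ‖g t‖ ≤ r * growth t) → ∀ d, 0 ≤ d → (∀ t, ‖f t - g t‖ ≤ d * growth t) →
      ∀ t, ‖T f t - T g t‖ ≤ d / 2 * growth t)
    {y y' : ℝ → Euc n} (hy : MemM r y) (hy' : MemM r y') (hTy : T y = y) (hTy' : T y' = y') :
    y = y' := by
  have key : ∀ k : ℕ, ∀ t, ‖y t - y' t‖ ≤ 2 * r * (1 / 2) ^ k * growth t := by
    intro k
    induction k with
    | zero =>
      intro t
      have := norm_sub_le (y t) (y' t)
      have := hy.norm_le t
      have := hy'.norm_le t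
      simp only [pow_zero]
      linarith
    | succ k ih =>
      intro t
      have := hlip y y' hy.1 hy'.1 hy.norm_le hy'.norm_le _ (by positivity) ih t
      rw [hTy, hTy'] at this
      exact this.trans_eq (by ring)
  funext t
  have hlim : Tendsto (fun k : ℕ => 2 * r * (1 / 2 : ℝ) ^ k * growth t) atTop (𝓝 0) := by
    have := ((tendsto_pow_atTop_nhds_zero_of_lt_one (r := (1 / 2 : ℝ)) (by norm_num)
      (by norm_num)).const_mul (2 * r)).mul_const (growth t)
    simpa using this
  have := ge_of_tendsto' hlim fun k => key k t
  exact sub_eq_zero.1 (norm_le_zero_iff.1 this)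

/-- A continuous field of size `O(|w|⁻ᵃ⁻¹)` whose derivative is of size `O(|w|⁻ᵃ⁻²)`. -/
structure DecayingField (G : Euc n → Euc n) (a K : ℝ) : Prop where
  continuous : Continuous G
  nonneg : 0 ≤ K
  norm_le : ∀ w, ‖G w‖ ≤ K * (1 + ‖w‖) ^ (-(a + 1))
  norm_sub_le : ∀ m, 0 < m → ∀ S : Set (Euc n), Convex ℝ S → (∀ w ∈ S, m ≤ 1 + ‖w‖) →
    ∀ w ∈ S, ∀ w' ∈ S, ‖G w - G w'‖ ≤ K * m ^ (-(a + 2)) * ‖w - w'‖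

lemma decayingField_neg_gradient {V : Euc n → ℝ} {a b₁ b₂ : ℝ} (ha : 0 < a) (hb₁ : 0 ≤ b₁)
    (hb₂ : 0 ≤ b₂) (hV : ContDiff ℝ 2 V)
    (h1 : ∀ w, ‖gradient V w‖ ≤ b₁ * (1 + ‖w‖) ^ (-(a + 1)))
    (h2 : ∀ w, ‖iteratedFDeriv ℝ 2 V w‖ ≤ b₂ * (1 + ‖w‖) ^ (-(a + 2))) :
    DecayingField (fun w => -gradient V w) a (b₁ + b₂) where
  continuous := by
    unfold gradient
    exact ((LinearIsometryEquiv.continuous _).comp (hV.continuous_fderiv (by norm_num))).neg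
  nonneg := by positivity
  norm_le w := by
    rw [norm_neg]
    refine (h1 w).trans ?_
    gcongr
    linarith
  norm_sub_le m hm S hS hmS w hw w' hw' := by
    have hd : ContDiff ℝ 1 (fderiv ℝ V) := hV.fderiv_right (by norm_num)
    have hbound : ∀ u ∈ S, ‖fderiv ℝ (fderiv ℝ V) u‖ ≤ b₂ * m ^ (-(a + 2)) := fun u hu => by
      rw [← norm_iteratedFDeriv_one, norm_iteratedFDeriv_fderiv]
      refine (h2 u).trans ?_
      gcongr b₂ * ?_
      exact Real.rpow_le_rpow_of_nonpos hm (hmS u hu) (by linarith)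
    have hmv := hS.norm_image_sub_le_of_norm_fderiv_le
      (fun u _ => (hd.differentiable (by norm_num)).differentiableAt) hbound hw hw'
    have : ‖-gradient V w - -gradient V w'‖ = ‖fderiv ℝ V w' - fderiv ℝ V w‖ := by
      unfold gradient
      rw [neg_sub_neg, ← map_sub, LinearIsometryEquiv.norm_map]
    rw [this, norm_sub_rev w w']
    refine hmv.trans ?_
    gcongr
    linarith

lemma DecayingField.add {G H : Euc n → Euc n} {a K L : ℝ} (hG : DecayingField G a K)
    (hH : DecayingField H a L) : DecayingField (fun w => G w + H w) a (K + L) where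
  continuous := hG.continuous.add hH.continuous
  nonneg := add_nonneg hG.nonneg hH.nonneg
  norm_le w := (norm_add_le _ _).trans <| by
    rw [add_mul]
    exact add_le_add (hG.norm_le w) (hH.norm_le w)
  norm_sub_le m hm S hS hmS w hw w' hw' := by
    rw [add_sub_add_comm, add_mul, add_mul]
    exact (norm_add_le _ _).trans (add_le_add (hG.norm_sub_le m hm S hS hmS w hw w' hw')
      (hH.norm_sub_le m hm S hS hmS w hw w' hw'))

/-- The slab of points whose `θ`-component is within `d` of `c`. -/
def slab (θ : Euc n) (c d : ℝ) : Set (Euc n) := {w | |⟪θ, w⟫ - c| ≤ d}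

lemma convex_slab (θ : Euc n) (c d : ℝ) : Convex ℝ (slab θ c d) := by
  have : slab θ c d = (innerSL ℝ θ : Euc n →ₗ[ℝ] ℝ) ⁻¹' Metric.closedBall c d := by
    ext w
    simp [slab, Real.dist_eq]
  rw [this]
  exact (convex_closedBall c d).linear_preimage _

section Orbit

variable {θ x : Euc n} {r s D : ℝ} {z : ℝ → Euc n}

lemma le_one_add_norm_of_mem_slab (hθ : ‖θ‖ = 1) (hr0 : 0 < r) (hr1 : r < 1)
    (hD : 2 * D + 2 ≤ s) (hs : 0 ≤ s) {τ : ℝ} {w : Euc n}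
    (hw : w ∈ slab θ (s * τ) (D * |τ| + r * (1 + |τ|))) :
    (1 - r) / 2 * (1 + s * |τ|) ≤ 1 + ‖w‖ := by
  have h1 : |⟪θ, w⟫| ≤ ‖w‖ := by simpa [hθ] using abs_real_inner_le_norm θ w
  have h2 : |s * τ| - |⟪θ, w⟫| ≤ |⟪θ, w⟫ - s * τ| := by
    rw [abs_sub_comm]; exact abs_sub_abs_le_abs_sub _ _
  have h3 : |⟪θ, w⟫ - s * τ| ≤ D * |τ| + r * (1 + |τ|) := hw
  rw [abs_mul, abs_of_nonneg hs] at h2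
  have h4 := abs_nonneg τ
  have h5 : (2 * D + 2) * |τ| ≤ s * |τ| := by gcongr
  have h6 : 0 ≤ r * (s * |τ|) := by positivity
  nlinarith

lemma orbit_mem_slab (hθ : ‖θ‖ = 1) (hperp : ⟪θ, x⟫ = 0) (hr0 : 0 < r)
    (hz : ∀ t, ‖z t - t • s • θ‖ ≤ D * |t|) (τ : ℝ) :
    z τ ∈ slab θ (s * τ) (D * |τ| + r * (1 + |τ|)) ∧
      ∀ v : Euc n, ‖v‖ ≤ r * growth τ →
        z τ + x + v ∈ slab θ (s * τ) (D * |τ| + r * (1 + |τ|)) := by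
  have hθθ : ⟪θ, θ⟫ = 1 := by rw [real_inner_self_eq_norm_sq, hθ]; norm_num
  have h1 : |⟪θ, z τ⟫ - s * τ| ≤ D * |τ| := by
    have : ⟪θ, z τ⟫ - s * τ = ⟪θ, z τ - τ • s • θ⟫ := by
      rw [inner_sub_right, inner_smul_right, inner_smul_right, hθθ]; ring
    rw [this]
    refine (abs_real_inner_le_norm _ _).trans ?_
    rw [hθ, one_mul]
    exact hz τ
  have h2 : 0 ≤ r * (1 + |τ|) := by positivity
  refine ⟨h1.trans (by linarith), fun v hv => ?_⟩
  have h3 : |⟪θ, v⟫| ≤ r * (1 + |τ|) := by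
    have h := abs_real_inner_le_norm θ v
    rw [hθ, one_mul] at h
    exact h.trans (hv.trans (by gcongr; exact growth_le τ))
  change |⟪θ, z τ + x + v⟫ - s * τ| ≤ _
  rw [inner_add_right, inner_add_right, hperp]
  calc |⟪θ, z τ⟫ + 0 + ⟪θ, v⟫ - s * τ| = |(⟪θ, z τ⟫ - s * τ) + ⟪θ, v⟫| := by ring_nf
    _ ≤ _ := (abs_add_le _ _).trans (add_le_add h1 h3)

lemma norm_field_sub_le {G : Euc n → Euc n} {a K : ℝ} (hG : DecayingField G a K)
    (hθ : ‖θ‖ = 1) (hr0 : 0 < r) (hr1 : r < 1) (hD : 2 * D + 2 ≤ s) (hs : 0 ≤ s)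
    {τ : ℝ} {w w' : Euc n} (hw : w ∈ slab θ (s * τ) (D * |τ| + r * (1 + |τ|)))
    (hw' : w' ∈ slab θ (s * τ) (D * |τ| + r * (1 + |τ|))) :
    ‖G w - G w'‖ ≤ K * (((1 - r) / 2) ^ (-(a + 2)) * (1 + s * |τ|) ^ (-(a + 2))) * ‖w - w'‖ := by
  have hr : 0 < (1 - r) / 2 := by linarith
  rw [← Real.mul_rpow hr.le (by positivity)]
  exact hG.norm_sub_le _ (by positivity) _ (convex_slab _ _ _)
    (fun u hu => le_one_add_norm_of_mem_slab hθ hr0 hr1 hD hs hu) w hw w' hw'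

lemma norm_field_le {G : Euc n → Euc n} {p K : ℝ} (hp : 0 ≤ p) (hK : 0 ≤ K)
    (hG : ∀ w, ‖G w‖ ≤ K * (1 + ‖w‖) ^ (-p))
    (hθ : ‖θ‖ = 1) (hr0 : 0 < r) (hr1 : r < 1) (hD : 2 * D + 2 ≤ s) (hs : 0 ≤ s)
    {τ : ℝ} {w : Euc n} (hw : w ∈ slab θ (s * τ) (D * |τ| + r * (1 + |τ|))) :
    ‖G w‖ ≤ K * (((1 - r) / 2) ^ (-p) * (1 + s * |τ|) ^ (-p)) := by
  have hr : 0 < (1 - r) / 2 := by linarith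
  rw [← Real.mul_rpow hr.le (by positivity)]
  refine (hG w).trans ?_
  gcongr K * ?_
  exact Real.rpow_le_rpow_of_nonpos (by positivity)
    (le_one_add_norm_of_mem_slab hθ hr0 hr1 hD hs hw) (by linarith)

end Orbit

section FixedPoint

variable {θ x : Euc n} {α r s D Kl Ks : ℝ} {z : ℝ → Euc n} {Fl Fs F : Euc n → Euc n}

/-- The constant in front of `weight` in the bounds for the integrand of `Aop`. -/
def integrandConst (α r Kl Ks X : ℝ) : ℝ :=
  (Kl * (X + 1) + Kl + Ks) * ((1 - r) / 2) ^ (-(α + 2))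

/-- The constant in front of `growth t / s` in the bounds for `Aop`. -/
def opConst (α r Kl Ks X : ℝ) : ℝ :=
  integrandConst α r Kl Ks X * (mass (1 + α / 2) * (mass (1 + α / 2) + 1))

lemma integrandConst_nonneg {X : ℝ} (hr1 : r < 1) (hKl : 0 ≤ Kl) (hKs : 0 ≤ Ks) (hX : 0 ≤ X) :
    0 ≤ integrandConst α r Kl Ks X := by
  have hr : 0 < (1 - r) / 2 := by linarith
  unfold integrandConst
  positivity

lemma norm_integrand_le (hα : 0 < α) (hFl : DecayingField Fl α Kl) (hKs : 0 ≤ Ks)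
    (hFs : ∀ w, ‖Fs w‖ ≤ Ks * (1 + ‖w‖) ^ (-(α + 2))) (hF : ∀ w, F w = Fl w + Fs w)
    (hθ : ‖θ‖ = 1) (hperp : ⟪θ, x⟫ = 0) (hr0 : 0 < r) (hr1 : r < 1) (hD : 2 * D + 2 ≤ s)
    (hs : 1 ≤ s) (hz : ∀ t, ‖z t - t • s • θ‖ ≤ D * |t|) {τ : ℝ} {v : Euc n}
    (hv : ‖v‖ ≤ r * growth τ) :
    ‖F (z τ + x + v) - Fl (z τ)‖ ≤
      integrandConst α r Kl Ks ‖x‖ * weight (1 + α / 2) s τ := by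
  have hs0 : 0 ≤ s := by linarith
  have hr : 0 < (1 - r) / 2 := by linarith
  have hKl := hFl.nonneg
  obtain ⟨m1, m2⟩ := orbit_mem_slab hθ hperp hr0 hz τ
  have b1 := norm_field_sub_le hFl hθ hr0 hr1 hD hs0 (m2 v hv) m1
  have b2 := norm_field_le (by linarith) hKs hFs hθ hr0 hr1 hD hs0 (m2 v hv)
  have hg := one_le_growth τ
  have hxv : ‖z τ + x + v - z τ‖ ≤ (‖x‖ + 1) * growth τ := by
    rw [show z τ + x + v - z τ = x + v by abel]
    refine (norm_add_le _ _).trans ?_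
    nlinarith [norm_nonneg x]
  set c := ((1 - r) / 2) ^ (-(α + 2))
  set q := (1 + s * |τ|) ^ (-(α + 2))
  have hc : 0 ≤ c := by positivity
  have hq : 0 ≤ q := by positivity
  calc ‖F (z τ + x + v) - Fl (z τ)‖
      = ‖(Fl (z τ + x + v) - Fl (z τ)) + Fs (z τ + x + v)‖ := by
        rw [hF]; congr 1; abel
    _ ≤ Kl * (c * q) * ((‖x‖ + 1) * growth τ) + Ks * (c * q) * growth τ := by
        refine (norm_add_le _ _).trans (add_le_add (b1.trans (by gcongr)) (b2.trans ?_))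
        exact le_mul_of_one_le_right (by positivity) hg
    _ = ((Kl * (‖x‖ + 1) + Ks) * c) * (q * growth τ) := by ring
    _ ≤ ((Kl * (‖x‖ + 1) + Kl + Ks) * c) * (q * growth τ) := by
        have := growth_pos τ
        gcongr ?_ * c * _
        linarith
    _ ≤ _ := by
        have := integrandConst_nonneg (α := α) hr1 hKl hKs (norm_nonneg x)
        exact mul_le_mul_of_nonneg_left (rpow_mul_growth_le_weight hα hs τ) this

lemma norm_integrand_sub_le (hα : 0 < α) (hF : DecayingField F α (Kl + Ks))
    (hKl : 0 ≤ Kl) (hθ : ‖θ‖ = 1) (hperp : ⟪θ, x⟫ = 0) (hr0 : 0 < r) (hr1 : r < 1)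
    (hD : 2 * D + 2 ≤ s) (hs : 1 ≤ s) (hz : ∀ t, ‖z t - t • s • θ‖ ≤ D * |t|) {τ d : ℝ}
    {v v' : Euc n} (hv : ‖v‖ ≤ r * growth τ) (hv' : ‖v'‖ ≤ r * growth τ) (hd : 0 ≤ d)
    (hvv : ‖v - v'‖ ≤ d * growth τ) :
    ‖F (z τ + x + v) - F (z τ + x + v')‖ ≤
      d * integrandConst α r Kl Ks ‖x‖ * weight (1 + α / 2) s τ := by
  have hs0 : 0 ≤ s := by linarith
  have hr : 0 < (1 - r) / 2 := by linarith
  have hK := hF.nonneg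
  obtain ⟨-, m2⟩ := orbit_mem_slab hθ hperp hr0 hz τ
  have b1 := norm_field_sub_le hF hθ hr0 hr1 hD hs0 (m2 v hv) (m2 v' hv')
  rw [show z τ + x + v - (z τ + x + v') = v - v' by abel] at b1
  have hw := rpow_mul_growth_le_weight hα hs τ
  have hw0 := weight_nonneg hs0 (1 + α / 2) τ
  unfold integrandConst
  set c := ((1 - r) / 2) ^ (-(α + 2))
  set q := (1 + s * |τ|) ^ (-(α + 2))
  have hc : 0 ≤ c := by positivity
  have hq : 0 ≤ q := by positivity
  calc _ ≤ (Kl + Ks) * (c * q) * (d * growth τ) := b1.trans (by gcongr)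
    _ = d * ((Kl + Ks) * c) * (q * growth τ) := by ring
    _ ≤ d * ((Kl + Ks) * c) * weight (1 + α / 2) s τ := by gcongr
    _ ≤ _ := by
        gcongr d * (?_ * c) * _
        have : 0 ≤ Kl * (‖x‖ + 1) := by positivity
        linarith

lemma continuous_Aop (hα : 0 < α) (hFl : DecayingField Fl α Kl) (hKs : 0 ≤ Ks)
    (hFs : ∀ w, ‖Fs w‖ ≤ Ks * (1 + ‖w‖) ^ (-(α + 2))) (hF : ∀ w, F w = Fl w + Fs w)
    (hFc : Continuous F) (hzc : Continuous z)
    (hθ : ‖θ‖ = 1) (hperp : ⟪θ, x⟫ = 0) (hr0 : 0 < r) (hr1 : r < 1) (hD : 2 * D + 2 ≤ s)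
    (hs : 1 ≤ s) (hz : ∀ t, ‖z t - t • s • θ‖ ≤ D * |t|) {f : ℝ → Euc n} (hf : Continuous f)
    (hfr : ∀ t, ‖f t‖ ≤ r * growth t) : Continuous (Aop Fl F z x f) := by
  have hFlc := hFl.continuous
  exact continuous_doubleIntegral (by linarith) hs
    (integrandConst_nonneg hr1 hFl.nonneg hKs (norm_nonneg x)) (by fun_prop)
    fun τ => norm_integrand_le hα hFl hKs hFs hF hθ hperp hr0 hr1 hD hs hz (hfr τ)

lemma norm_Aop_le (hα : 0 < α) (hFl : DecayingField Fl α Kl) (hKs : 0 ≤ Ks)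
    (hFs : ∀ w, ‖Fs w‖ ≤ Ks * (1 + ‖w‖) ^ (-(α + 2))) (hF : ∀ w, F w = Fl w + Fs w)
    (hθ : ‖θ‖ = 1) (hperp : ⟪θ, x⟫ = 0) (hr0 : 0 < r) (hr1 : r < 1) (hD : 2 * D + 2 ≤ s)
    (hs : 1 ≤ s) (hz : ∀ t, ‖z t - t • s • θ‖ ≤ D * |t|) {f : ℝ → Euc n}
    (hfr : ∀ t, ‖f t‖ ≤ r * growth t) (t : ℝ) :
    ‖Aop Fl F z x f t‖ ≤ opConst α r Kl Ks ‖x‖ / s * growth t :=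
  norm_doubleIntegral_le (by linarith) hs
    (integrandConst_nonneg hr1 hFl.nonneg hKs (norm_nonneg x))
    (fun τ => norm_integrand_le hα hFl hKs hFs hF hθ hperp hr0 hr1 hD hs hz (hfr τ)) t

lemma norm_Aop_sub_le (hα : 0 < α) (hFl : DecayingField Fl α Kl) (hKs : 0 ≤ Ks)
    (hFs : ∀ w, ‖Fs w‖ ≤ Ks * (1 + ‖w‖) ^ (-(α + 2))) (hF : ∀ w, F w = Fl w + Fs w)
    (hFd : DecayingField F α (Kl + Ks)) (hzc : Continuous z)
    (hθ : ‖θ‖ = 1) (hperp : ⟪θ, x⟫ = 0) (hr0 : 0 < r) (hr1 : r < 1) (hD : 2 * D + 2 ≤ s)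
    (hs : 1 ≤ s) (hz : ∀ t, ‖z t - t • s • θ‖ ≤ D * |t|) {f g : ℝ → Euc n}
    (hf : Continuous f) (hg : Continuous g) (hfr : ∀ t, ‖f t‖ ≤ r * growth t)
    (hgr : ∀ t, ‖g t‖ ≤ r * growth t) {d : ℝ} (hd : 0 ≤ d)
    (hfg : ∀ t, ‖f t - g t‖ ≤ d * growth t) (t : ℝ) :
    ‖Aop Fl F z x f t - Aop Fl F z x g t‖ ≤
      d * (opConst α r Kl Ks ‖x‖ / s) * growth t := by
  have hFlc := hFl.continuous
  have hFc := hFd.continuous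
  have hp : 1 < 1 + α / 2 := by linarith
  have hB := integrandConst_nonneg (α := α) hr1 hFl.nonneg hKs (norm_nonneg x)
  have hb : ∀ {f : ℝ → Euc n}, (∀ t, ‖f t‖ ≤ r * growth t) → ∀ τ, _ := fun hfr τ =>
    norm_integrand_le hα hFl hKs hFs hF hθ hperp hr0 hr1 hD hs hz (hfr τ)
  have hsub := doubleIntegral_sub hp hs hB (by fun_prop) (by fun_prop) (hb hfr) (hb hgr) t
  change ‖doubleIntegral _ t - doubleIntegral _ t‖ ≤ _
  rw [← hsub]
  refine (norm_doubleIntegral_le hp hs (mul_nonneg hd hB) (fun τ => ?_) t).trans_eq ?_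
  · rw [sub_sub_sub_cancel_right]
    exact norm_integrand_sub_le hα hFd hFl.nonneg hθ hperp hr0 hr1 hD hs hz (hfr τ) (hgr τ) hd
      (hfg τ)
  · unfold opConst
    ring

lemma existsUnique_fixedPoint_Aop (hα : 0 < α) (hFl : DecayingField Fl α Kl) (hKs : 0 ≤ Ks)
    (hFs : ∀ w, ‖Fs w‖ ≤ Ks * (1 + ‖w‖) ^ (-(α + 2))) (hF : ∀ w, F w = Fl w + Fs w)
    (hFd : DecayingField F α (Kl + Ks)) (hzc : Continuous z)
    (hθ : ‖θ‖ = 1) (hperp : ⟪θ, x⟫ = 0) (hr0 : 0 < r) (hr1 : r < 1) (hD : 2 * D + 2 ≤ s)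
    (hs : 1 ≤ s) (hz : ∀ t, ‖z t - t • s • θ‖ ≤ D * |t|)
    (hsmall : opConst α r Kl Ks ‖x‖ / s ≤ r / 2) :
    ∃! y, MemM r y ∧ Aop Fl F z x y = y := by
  have hlip : ∀ f g, Continuous f → Continuous g → (∀ t, ‖f t‖ ≤ r * growth t) →
      (∀ t, ‖g t‖ ≤ r * growth t) → ∀ d, 0 ≤ d → (∀ t, ‖f t - g t‖ ≤ d * growth t) →
      ∀ t, ‖Aop Fl F z x f t - Aop Fl F z x g t‖ ≤ d / 2 * growth t := by
    intro f g hf hg hfr hgr d hd hfg t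
    refine (norm_Aop_sub_le hα hFl hKs hFs hF hFd hzc hθ hperp hr0 hr1 hD hs hz hf hg hfr hgr hd
      hfg t).trans ?_
    have := growth_pos t
    rw [div_eq_mul_inv d]
    gcongr
    linarith
  obtain ⟨y, hy, hTy⟩ := exists_fixedPoint_of_contracting hr0 (Aop Fl F z x)
    (fun f hf hfr =>
      continuous_Aop hα hFl hKs hFs hF hFd.continuous hzc hθ hperp hr0 hr1 hD hs hz hf hfr)
    (fun f _ hfr t =>
      (norm_Aop_le hα hFl hKs hFs hF hθ hperp hr0 hr1 hD hs hz hfr t).trans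
        (mul_le_mul_of_nonneg_right hsmall (growth_pos t).le)) hlip
  exact ⟨y, ⟨hy, hTy⟩, fun y' ⟨hy', hTy'⟩ =>
    fixedPoint_unique_of_contracting hr0 (Aop Fl F z x) hlip hy' hy hTy' hTy⟩

end FixedPoint

lemma integrable_field_line {G : Euc n → Euc n} {θ x : Euc n} {p K : ℝ} (hp : 1 < p) (hK : 0 ≤ K)
    (hc : Continuous G) (hG : ∀ w, ‖G w‖ ≤ K * (1 + ‖w‖) ^ (-p)) (hθ : ‖θ‖ = 1)
    (hperp : ⟪θ, x⟫ = 0) : Integrable fun τ : ℝ => G (τ • θ + x) := by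
  refine ((integrable_one_add_abs_rpow hp).const_mul K).mono'
    (by fun_prop : Continuous _).aestronglyMeasurable (ae_of_all _ fun τ => (hG _).trans ?_)
  have : |τ| ≤ ‖τ • θ + x‖ := by
    have h := abs_real_inner_le_norm θ (τ • θ + x)
    rw [inner_add_right, inner_smul_right, hperp, real_inner_self_eq_norm_sq, hθ] at h
    simpa using h
  gcongr K * ?_
  exact Real.rpow_le_rpow_of_nonpos (by positivity) (by linarith) (by linarith)

lemma tendsto_smul_integral_orbit {F : Euc n → Euc n} {θ x : Euc n} {α r K C D₀ : ℝ}
    {z Y : ℝ → ℝ → Euc n} (hα : 0 < α) (hFd : DecayingField F α K)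
    (hθ : ‖θ‖ = 1) (hperp : ⟪θ, x⟫ = 0) (hr0 : 0 < r) (hr1 : r < 1)
    (hz : ∀ᶠ s in atTop, Continuous (z s) ∧ ∀ t, ‖z s t - t • s • θ‖ ≤ D₀ / s * |t|)
    (hY : ∀ᶠ s in atTop, Continuous (Y s) ∧ (∀ t, ‖Y s t‖ ≤ r * growth t) ∧
      ∀ t, ‖Y s t‖ ≤ C / s * growth t) :
    Tendsto (fun s : ℝ => s • ∫ τ : ℝ, F (z s τ + x + Y s τ)) atTop
      (𝓝 (∫ τ : ℝ, F (τ • θ + x))) := by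
  have hFc := hFd.continuous
  have hr : 0 < (1 - r) / 2 := by linarith
  have hscale : (fun s : ℝ => ∫ u : ℝ, F (z s (u / s) + x + Y s (u / s))) =ᶠ[atTop]
      fun s : ℝ => s • ∫ τ : ℝ, F (z s τ + x + Y s τ) := by
    filter_upwards [eventually_gt_atTop 0] with s hs
    rw [Measure.integral_comp_div (fun τ => F (z s τ + x + Y s τ)) s, abs_of_pos hs]
  have hdiv : ∀ c : ℝ, Tendsto (fun s : ℝ => c / s) atTop (𝓝 0) := fun c =>
    tendsto_const_nhds.div_atTop tendsto_id
  refine Tendsto.congr' hscale (tendsto_integral_filter_of_dominated_convergence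
    (fun u => K * (((1 - r) / 2) ^ (-(α + 1)) * (1 + |u|) ^ (-(α + 1)))) ?_ ?_ ?_ ?_)
  · filter_upwards [hz, hY] with s hzs hYs
    obtain ⟨hzc, -⟩ := hzs
    obtain ⟨hYc, -⟩ := hYs
    exact (by fun_prop : Continuous fun u => F (z s (u / s) + x + Y s (u / s))).aestronglyMeasurable
  · filter_upwards [hz, hY, eventually_ge_atTop (4 : ℝ),
      (hdiv D₀).eventually (eventually_le_nhds one_pos)] with s hzs hYs hs hD
    refine ae_of_all _ fun u => ?_
    have hs0 : 0 < s := by linarith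
    have h := norm_field_le (by linarith) hFd.nonneg hFd.norm_le hθ hr0 hr1
      (show 2 * (D₀ / s) + 2 ≤ s by linarith) hs0.le
      ((orbit_mem_slab hθ hperp hr0 hzs.2 (u / s)).2 _ (hYs.2.1 (u / s)))
    rwa [abs_div, abs_of_pos hs0, mul_div_cancel₀ _ hs0.ne'] at h
  · exact ((integrable_one_add_abs_rpow (by linarith)).const_mul _).const_mul _
  · refine ae_of_all _ fun u => (hFc.tendsto _).comp ?_
    have hz0 : Tendsto (fun s => z s (u / s)) atTop (𝓝 (u • θ)) := by
      rw [tendsto_iff_norm_sub_tendsto_zero]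
      have hlim : Tendsto (fun s : ℝ => D₀ / s * (|u| / s)) atTop (𝓝 0) := by
        simpa using (hdiv D₀).mul (hdiv |u|)
      refine squeeze_zero' (Eventually.of_forall fun _ => norm_nonneg _) ?_ hlim
      filter_upwards [hz, eventually_gt_atTop 0] with s hzs hs
      have h := hzs.2 (u / s)
      rwa [smul_smul, div_mul_cancel₀ _ hs.ne', abs_div, abs_of_pos hs] at h
    have hY0 : Tendsto (fun s => Y s (u / s)) atTop (𝓝 0) := by
      rw [tendsto_zero_iff_norm_tendsto_zero]
      have hlim : Tendsto (fun s : ℝ => C / s * growth (u / s)) atTop (𝓝 0) := by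
        simpa using (hdiv C).mul ((continuous_growth.tendsto 0).comp (hdiv u))
      refine squeeze_zero' (Eventually.of_forall fun _ => norm_nonneg _) ?_ hlim
      filter_upwards [hY] with s hYs using hYs.2.2 (u / s)
    simpa using (hz0.add_const x).add hY0

theorem statement_7
    (n : ℕ) (hn : 2 ≤ n) (α : ℝ) (hα0 : 0 < α) (hα1 : α ≤ 1)
    (Vl Vs : Euc n → ℝ) (βl0 βl1 βl2 βs1 βs2 βs3 : ℝ)
    (hβl0 : 0 < βl0) (hβl1 : 0 < βl1) (hβl2 : 0 < βl2)
    (hβs1 : 0 < βs1) (hβs2 : 0 < βs2) (hβs3 : 0 < βs3)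
    (hVl : LongRange α βl0 βl1 βl2 Vl) (hVs : ShortRange α βs1 βs2 βs3 Vs)
    (Fl Fs F : Euc n → Euc n)
    (hFl : ∀ y, Fl y = -gradient Vl y) (hFs : ∀ y, Fs y = -gradient Vs y)
    (hF : ∀ y, F y = Fl y + Fs y)
    (θ x : Euc n) (hθ : ‖θ‖ = 1) (hperp : ⟪θ, x⟫ = 0)
    (r : ℝ) (hr0 : 0 < r) (hr1 : r < 1)
    (zm : ℝ → ℝ → Euc n)
    (hzm : ∀ s : ℝ, Real.sqrt (2 ^ 5 * (n : ℝ) * max βl1 βl2 / α) ≤ s → IsFreeSol Fl 0 (s • θ) atBot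
      (2 ^ ((5:ℝ)/2) * Real.sqrt n * βl1 / (α * s)) (zm s))
 :
    (∀ᶠ s in atTop, ∃! y : ℝ → Euc n, MemM r y ∧ Aop Fl F (zm s) x y = y) ∧
    ∀ Y : ℝ → ℝ → Euc n,
      (∀ᶠ s in atTop, MemM r (Y s) ∧ Aop Fl F (zm s) x (Y s) = Y s) →
      Tendsto (fun s : ℝ => s • ∫ τ : ℝ, F (zm s τ + x + Y s τ)) atTop
        (𝓝 ((∫ τ : ℝ, Fl (τ • θ + x)) + ∫ τ : ℝ, Fs (τ • θ + x))) := by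
  obtain ⟨hVl2, -, hVl1, hVl3⟩ := hVl
  obtain ⟨hVs2, -, hVs1, hVs3⟩ := hVs
  have hFl' : Fl = fun w => -gradient Vl w := funext hFl
  have hFs' : Fs = fun w => -gradient Vs w := funext hFs
  have hF' : F = fun w => Fl w + Fs w := funext hF
  set Kl := βl1 + βl2
  set Ks := βs2 + βs3
  have hKs : 0 ≤ Ks := by positivity
  have hweaken : ∀ (w : Euc n) {p q : ℝ}, q ≤ p → (1 + ‖w‖) ^ (-p) ≤ (1 + ‖w‖) ^ (-q) :=
    fun w p q h => Real.rpow_le_rpow_of_exponent_le (by linarith [norm_nonneg w]) (by linarith)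
  have hFld : DecayingField Fl α Kl :=
    hFl' ▸ decayingField_neg_gradient hα0 hβl1.le hβl2.le hVl2 hVl1 hVl3
  have hFsd : DecayingField Fs α Ks := by
    rw [hFs']
    refine decayingField_neg_gradient hα0 hβs2.le hβs3.le hVs2 (fun w => (hVs1 w).trans ?_)
      (fun w => (hVs3 w).trans ?_)
    · gcongr βs2 * ?_
      exact hweaken w (by linarith)
    · gcongr βs3 * ?_
      exact hweaken w (by linarith)
  have hFsb : ∀ w, ‖Fs w‖ ≤ Ks * (1 + ‖w‖) ^ (-(α + 2)) := fun w => by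
    rw [hFs w, norm_neg]
    refine (hVs1 w).trans ?_
    gcongr
    exact le_add_of_nonneg_right hβs3.le
  have hFd : DecayingField F α (Kl + Ks) := hF' ▸ hFld.add hFsd
  set D₀ := 2 ^ ((5:ℝ)/2) * Real.sqrt n * βl1 / α with hD₀
  have hz : ∀ᶠ s in atTop,
      Continuous (zm s) ∧ ∀ t, ‖zm s t - t • s • θ‖ ≤ D₀ / s * |t| := by
    filter_upwards [eventually_ge_atTop
      (Real.sqrt (2 ^ 5 * (n : ℝ) * max βl1 βl2 / α))] with s hs
    obtain ⟨hc, -, -, -, hb⟩ := hzm s hs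
    refine ⟨hc.continuous, fun t => ?_⟩
    have := hb t
    rwa [sub_zero, ← div_div] at this
  have hdiv : ∀ c : ℝ, Tendsto (fun s : ℝ => c / s) atTop (𝓝 0) := fun c =>
    tendsto_const_nhds.div_atTop tendsto_id
  have hD : ∀ᶠ s : ℝ in atTop, 4 ≤ s ∧ D₀ / s ≤ 1 :=
    (eventually_ge_atTop 4).and ((hdiv D₀).eventually (eventually_le_nhds one_pos))
  refine ⟨?_, fun Y hY => ?_⟩
  · filter_upwards [hz, hD, (hdiv (opConst α r Kl Ks ‖x‖)).eventually
      (eventually_le_nhds (half_pos hr0))] with s hzs hDs hsmall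
    exact existsUnique_fixedPoint_Aop hα0 hFld hKs hFsb hF hFd hzs.1 hθ hperp hr0 hr1
      (by linarith) (by linarith) hzs.2 hsmall
  · have hsum : ∫ τ : ℝ, F (τ • θ + x) =
        (∫ τ : ℝ, Fl (τ • θ + x)) + ∫ τ : ℝ, Fs (τ • θ + x) := by
      rw [hF']
      exact integral_add
        (integrable_field_line (by linarith) hFld.nonneg hFld.continuous hFld.norm_le hθ hperp)
        (integrable_field_line (by linarith) hFsd.nonneg hFsd.continuous hFsd.norm_le hθ hperp)
    rw [← hsum]
    refine tendsto_smul_integral_orbit (C := opConst α r Kl Ks ‖x‖) hα0 hFd hθ hperp hr0 hr1 hz ?_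
    filter_upwards [hY, hz, hD] with s hYs hzs hDs
    refine ⟨hYs.1.1, hYs.1.norm_le, fun t => ?_⟩
    have h := norm_Aop_le hα0 hFld hKs hFsb hF hθ hperp hr0 hr1
      (show 2 * (D₀ / s) + 2 ≤ s by linarith) (by linarith) hzs.2 hYs.1.norm_le t
    rwa [hYs.2] at h

end Paper
end
end
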